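/- There exist constants c₁, c₂ > 0, depending only on τ₁, τ₂, and ε, such that for every a ∈ (0, min(τ₁, τ₂)/2), all 2π-periodic twice continuously differentiable functions h, g : ℝ → ℂ, and every doubly periodic function v : ℝ² → ℂ of the following form, one has (∫_S (|∂ₓv|² + |∂ᵧv|²))^{1/2} ≤ c₁·(∫_0^{2π} (|g(φ)|² + |g″(φ)|²) dφ)^{1/2} + (c₂/a)·(∫_0^{2π} (|h(φ)|² + |h″(φ)|²) dφ)^{1/2}. The form of v: there exist twice continuously differentiable functions V_in on a neighborhood of the closure of D and V_ex on a neighborhood of ℝ² ∖ D with v = V_in on D and v = V_ex on ℝ² ∖ closure(D), ΔV_in = 0 on D and ΔV_ex = 0 on ℝ² ∖ closure(D), v(r + (τ₁,0)) = v(r) = v(r + (0,τ₂)) for all r, v(0,0) = 0, and on the circle of radius a around each p ∈ L the jump conditions V_ex(p + a(cos φ, sin φ)) − V_in(p + a(cos φ, sin φ)) = h(φ) and ∂V_ex/∂n − (1/ε)·∂V_in/∂n = g(φ) hold for all φ, where ∂/∂n is the radial derivative with respect to p. -/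

import Mathlib

open MeasureTheory Set
open scoped Classical

/-- The lattice `L = {(m·τ₁, n·τ₂) : m, n ∈ ℤ}` of centers in `ℝ²`. -/
def centers (τ₁ τ₂ : ℝ) : Set (ℝ × ℝ) := {p | ∃ m n : ℤ, p = (m * τ₁, n * τ₂)}

/-- `D`: the union of the open Euclidean disks of radius `a` centered at the
lattice points. -/
def disks (τ₁ τ₂ a : ℝ) : Set (ℝ × ℝ) :=
  {q | ∃ p ∈ centers τ₁ τ₂, (q.1 - p.1) ^ 2 + (q.2 - p.2) ^ 2 < a ^ 2}

/-- The piecewise dielectric constant `ε̃`, equal to `ε` on `D` and `1` elsewhere. -/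
noncomputable def epsTilde (τ₁ τ₂ a ε : ℝ) (q : ℝ × ℝ) : ℝ :=
  if q ∈ disks τ₁ τ₂ a then ε else 1

/-- The fundamental cell `S = [−τ₁/2, τ₁/2] × [−τ₂/2, τ₂/2]`. -/
def cell (τ₁ τ₂ : ℝ) : Set (ℝ × ℝ) :=
  Icc (-τ₁ / 2) (τ₁ / 2) ×ˢ Icc (-τ₂ / 2) (τ₂ / 2)

/-- The Laplacian `Δf = ∂²f/∂x² + ∂²f/∂y²` of `f : ℝ² → ℂ`. -/
noncomputable def lap (f : ℝ × ℝ → ℂ) (q : ℝ × ℝ) : ℂ :=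
  fderiv ℝ (fun p => fderiv ℝ f p (1, 0)) q (1, 0) +
    fderiv ℝ (fun p => fderiv ℝ f p (0, 1)) q (0, 1)

/-- `u` is a transmission function with pieces `Uin`, `Uex`: `Uin` is `C²` on a
neighborhood of the closed disks, `Uex` is `C²` on a neighborhood of the
complement of the open disks, `u` is glued from them, the pieces agree on the
circles, and the normal (radial) derivatives satisfy
`(1/ε)·∂Uin/∂n = ∂Uex/∂n` there. -/
structure IsTransmission (τ₁ τ₂ a ε : ℝ) (u Uin Uex : ℝ × ℝ → ℂ) : Prop where
  smooth_in : ∃ N : Set (ℝ × ℝ), IsOpen N ∧ closure (disks τ₁ τ₂ a) ⊆ N ∧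
    ContDiffOn ℝ 2 Uin N
  smooth_ex : ∃ N : Set (ℝ × ℝ), IsOpen N ∧ (disks τ₁ τ₂ a)ᶜ ⊆ N ∧
    ContDiffOn ℝ 2 Uex N
  eq_in : ∀ q ∈ disks τ₁ τ₂ a, u q = Uin q
  eq_ex : ∀ q ∉ disks τ₁ τ₂ a, u q = Uex q
  continuity : ∀ p ∈ centers τ₁ τ₂, ∀ q : ℝ × ℝ,
    (q.1 - p.1) ^ 2 + (q.2 - p.2) ^ 2 = a ^ 2 → Uin q = Uex q
  flux : ∀ p ∈ centers τ₁ τ₂, ∀ q : ℝ × ℝ,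
    (q.1 - p.1) ^ 2 + (q.2 - p.2) ^ 2 = a ^ 2 →
      (1 / ε : ℂ) * fderiv ℝ Uin q (q.1 - p.1, q.2 - p.2) =
        fderiv ℝ Uex q (q.1 - p.1, q.2 - p.2)

/-- The divergence theorem on a closed rectangle for continuously differentiable fields. -/
theorem setIntegral_divergence_rectangle {A B : ℝ × ℝ → ℂ} {Ω : Set (ℝ × ℝ)} (hΩ : IsOpen Ω)
    (hA : ContDiffOn ℝ 1 A Ω) (hB : ContDiffOn ℝ 1 B Ω) {x₀ x₁ y₀ y₁ : ℝ} (hx : x₀ ≤ x₁)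
    (hy : y₀ ≤ y₁) (hsub : Icc x₀ x₁ ×ˢ Icc y₀ y₁ ⊆ Ω) :
    (∫ p in Icc x₀ x₁ ×ˢ Icc y₀ y₁, (fderiv ℝ A p (1, 0) + fderiv ℝ B p (0, 1))) =
      (((∫ x in x₀..x₁, B (x, y₁)) - ∫ x in x₀..x₁, B (x, y₀)) +
        ∫ y in y₀..y₁, A (x₁, y)) - ∫ y in y₀..y₁, A (x₀, y) := by
  rw [Icc_prod_Icc] at hsub ⊢
  have hsub' : Ioo x₀ x₁ ×ˢ Ioo y₀ y₁ ⊆ Ω := fun p hp =>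
    hsub ⟨⟨hp.1.1.le, hp.2.1.le⟩, ⟨hp.1.2.le, hp.2.2.le⟩⟩
  refine integral_divergence_prod_Icc_of_hasFDerivAt_of_le A B (fderiv ℝ A) (fderiv ℝ B)
    (x₀, y₀) (x₁, y₁) ⟨hx, hy⟩ (hA.continuousOn.mono hsub) (hB.continuousOn.mono hsub)
    (fun p hp => ((hA.differentiableOn one_ne_zero).differentiableAt
      (hΩ.mem_nhds (hsub' hp))).hasFDerivAt)
    (fun p hp => ((hB.differentiableOn one_ne_zero).differentiableAt
      (hΩ.mem_nhds (hsub' hp))).hasFDerivAt) ?_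
  refine ContinuousOn.integrableOn_compact isCompact_Icc (ContinuousOn.mono ?_ hsub)
  exact ((hA.continuousOn_fderiv_of_isOpen hΩ le_rfl).clm_apply continuousOn_const).add
    ((hB.continuousOn_fderiv_of_isOpen hΩ le_rfl).clm_apply continuousOn_const)

theorem setIntegral_annulus_eq_polar {E : Type*} [NormedAddCommGroup E] [NormedSpace ℝ E]
    (F : ℝ × ℝ → E) {r₀ r₁ : ℝ} (h₀ : 0 ≤ r₀) (hr : r₀ < r₁) :
    (∫ q in {q : ℝ × ℝ | r₀ ^ 2 ≤ q.1 ^ 2 + q.2 ^ 2 ∧ q.1 ^ 2 + q.2 ^ 2 < r₁ ^ 2}, F q) =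
      ∫ p in Icc r₀ r₁ ×ˢ Icc (-Real.pi) Real.pi,
        p.1 • F (p.1 * Real.cos p.2, p.1 * Real.sin p.2) := by
  have hmeas : MeasurableSet
      {q : ℝ × ℝ | r₀ ^ 2 ≤ q.1 ^ 2 + q.2 ^ 2 ∧ q.1 ^ 2 + q.2 ^ 2 < r₁ ^ 2} := by
    rw [ofPred_and]
    exact (measurableSet_le (by fun_prop) (by fun_prop)).inter
      (measurableSet_lt (by fun_prop) (by fun_prop))
  have hset : (Icc r₀ r₁ ×ˢ Icc (-Real.pi) Real.pi : Set (ℝ × ℝ)) =ᵐ[volume]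
      ((Ioi 0 ∩ Ico r₀ r₁) ×ˢ Ioo (-Real.pi) Real.pi : Set (ℝ × ℝ)) := by
    refine Measure.set_prod_ae_eq ?_ Ioo_ae_eq_Icc.symm
    refine (Filter.EventuallyLE.antisymm ?_ ?_ : (Ioi 0 ∩ Ico r₀ r₁ : Set ℝ) =ᵐ[volume] _).symm
    · exact (inter_subset_right.trans Ico_subset_Icc_self).eventuallyLE
    · exact Ioo_ae_eq_Icc.symm.le.trans
        (show Ioo r₀ r₁ ⊆ Ioi 0 ∩ Ico r₀ r₁ from fun x hx =>
          ⟨h₀.trans_lt hx.1, hx.1.le, hx.2⟩).eventuallyLE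
  rw [setIntegral_congr_set hset, ← integral_indicator hmeas, ← integral_comp_polarCoord_symm,
    polarCoord_target, ← integral_indicator (measurableSet_Ioi.prod measurableSet_Ioo),
    ← integral_indicator ((measurableSet_Ioi.inter measurableSet_Ico).prod measurableSet_Ioo)]
  refine integral_congr_ae (Filter.Eventually.of_forall fun p => ?_)
  have hsq : (p.1 * Real.cos p.2) ^ 2 + (p.1 * Real.sin p.2) ^ 2 = p.1 ^ 2 := by
    linear_combination p.1 ^ 2 * Real.cos_sq_add_sin_sq p.2
  simp only [indicator, mem_prod, mem_inter_iff, mem_ofPred_eq, polarCoord_symm_apply, hsq, mem_Ico,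
    mem_Ioi]
  by_cases hp : 0 < p.1
  · simp only [sq_le_sq₀ h₀ hp.le, sq_lt_sq₀ hp.le (h₀.trans hr.le)]
    by_cases hp' : p.2 ∈ Ioo (-Real.pi) Real.pi <;> by_cases h1 : r₀ ≤ p.1 ∧ p.1 < r₁ <;>
      simp [hp, hp', h1]
  · simp [hp]

theorem fderiv_apply_fst {A : ℝ × ℝ → ℂ} {p : ℝ × ℝ} {d : ℂ} (hA : DifferentiableAt ℝ A p)
    (hd : HasDerivAt (fun x => A (x, p.2)) d p.1) : fderiv ℝ A p (1, 0) = d :=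
  (HasFDerivAt.comp_hasDerivAt p.1 (f := fun x => (x, p.2)) hA.hasFDerivAt
    ((hasDerivAt_id p.1).prodMk (hasDerivAt_const p.1 p.2))).unique hd

theorem fderiv_apply_snd {A : ℝ × ℝ → ℂ} {p : ℝ × ℝ} {d : ℂ} (hA : DifferentiableAt ℝ A p)
    (hd : HasDerivAt (fun y => A (p.1, y)) d p.2) : fderiv ℝ A p (0, 1) = d :=
  (HasFDerivAt.comp_hasDerivAt p.2 (f := fun y => (p.1, y)) hA.hasFDerivAt
    ((hasDerivAt_const p.2 p.1).prodMk (hasDerivAt_id p.2))).unique hd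

theorem fderiv_apply_pair (L : ℝ × ℝ →L[ℝ] ℂ) (x y : ℝ) :
    L (x, y) = x * L (1, 0) + y * L (0, 1) := by
  have : ((x, y) : ℝ × ℝ) = x • ((1, 0) : ℝ × ℝ) + y • ((0, 1) : ℝ × ℝ) := by simp
  rw [this, map_add, map_smul, map_smul]; simp

theorem hasDerivAt_polar_radial {P : ℝ × ℝ → ℂ} {r φ : ℝ}
    (hP : DifferentiableAt ℝ P (r * Real.cos φ, r * Real.sin φ)) :
    HasDerivAt (fun r : ℝ => P (r * Real.cos φ, r * Real.sin φ))
      (Real.cos φ * fderiv ℝ P (r * Real.cos φ, r * Real.sin φ) (1, 0) +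
        Real.sin φ * fderiv ℝ P (r * Real.cos φ, r * Real.sin φ) (0, 1)) r := by
  rw [← fderiv_apply_pair]
  have := HasFDerivAt.comp_hasDerivAt r (f := fun r : ℝ => (r * Real.cos φ, r * Real.sin φ))
    hP.hasFDerivAt (((hasDerivAt_id r).mul_const _).prodMk ((hasDerivAt_id r).mul_const _))
  exact this.congr_deriv (by simp)

theorem hasDerivAt_polar_angular {P : ℝ × ℝ → ℂ} {r φ : ℝ}
    (hP : DifferentiableAt ℝ P (r * Real.cos φ, r * Real.sin φ)) :
    HasDerivAt (fun φ : ℝ => P (r * Real.cos φ, r * Real.sin φ))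
      (r * (-Real.sin φ * fderiv ℝ P (r * Real.cos φ, r * Real.sin φ) (1, 0) +
        Real.cos φ * fderiv ℝ P (r * Real.cos φ, r * Real.sin φ) (0, 1))) φ := by
  have := HasFDerivAt.comp_hasDerivAt φ (f := fun φ : ℝ => (r * Real.cos φ, r * Real.sin φ))
    hP.hasFDerivAt (((Real.hasDerivAt_cos φ).const_mul r).prodMk
      ((Real.hasDerivAt_sin φ).const_mul r))
  rw [fderiv_apply_pair] at this
  refine this.congr_deriv ?_
  push_cast; ring

/-- The radial component of the field `(P, Q)` as a function of the polar coordinates. -/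
noncomputable def radialPart (P Q : ℝ × ℝ → ℂ) (p : ℝ × ℝ) : ℂ :=
  Real.cos p.2 * P (p.1 * Real.cos p.2, p.1 * Real.sin p.2) +
    Real.sin p.2 * Q (p.1 * Real.cos p.2, p.1 * Real.sin p.2)

/-- The angular component of the field `(P, Q)` as a function of the polar coordinates. -/
noncomputable def angularPart (P Q : ℝ × ℝ → ℂ) (p : ℝ × ℝ) : ℂ :=
  -Real.sin p.2 * P (p.1 * Real.cos p.2, p.1 * Real.sin p.2) +
    Real.cos p.2 * Q (p.1 * Real.cos p.2, p.1 * Real.sin p.2)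

/-- The divergence, in polar coordinates, of the field `(P, Q)` multiplied by `M`. -/
theorem polar_divergence_mul {P Q M : ℝ × ℝ → ℂ} {p : ℝ × ℝ}
    (hP : DifferentiableAt ℝ P (p.1 * Real.cos p.2, p.1 * Real.sin p.2))
    (hQ : DifferentiableAt ℝ Q (p.1 * Real.cos p.2, p.1 * Real.sin p.2))
    (hM : DifferentiableAt ℝ M p) :
    fderiv ℝ (fun p : ℝ × ℝ => M p * (p.1 * radialPart P Q p)) p (1, 0) +
      fderiv ℝ (fun p : ℝ × ℝ => M p * angularPart P Q p) p (0, 1) =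
      p.1 * (M p * (fderiv ℝ P (p.1 * Real.cos p.2, p.1 * Real.sin p.2) (1, 0) +
        fderiv ℝ Q (p.1 * Real.cos p.2, p.1 * Real.sin p.2) (0, 1))) +
      (fderiv ℝ M p (1, 0) * (p.1 * radialPart P Q p) +
        fderiv ℝ M p (0, 1) * angularPart P Q p) := by
  unfold radialPart angularPart
  obtain ⟨r, φ⟩ := p
  dsimp only at *
  have hpol : DifferentiableAt ℝ (fun p : ℝ × ℝ => (p.1 * Real.cos p.2, p.1 * Real.sin p.2))
    (r, φ) := by fun_prop
  have hP' : DifferentiableAt ℝ (fun p : ℝ × ℝ => P (p.1 * Real.cos p.2, p.1 * Real.sin p.2))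
    (r, φ) := DifferentiableAt.comp (r, φ) (g := P) hP hpol
  have hQ' : DifferentiableAt ℝ (fun p : ℝ × ℝ => Q (p.1 * Real.cos p.2, p.1 * Real.sin p.2))
    (r, φ) := DifferentiableAt.comp (r, φ) (g := Q) hQ hpol
  have hc : DifferentiableAt ℝ (fun p : ℝ × ℝ => (Real.cos p.2 : ℂ)) (r, φ) :=
    Complex.ofRealCLM.differentiableAt.comp (r, φ) (f := fun p : ℝ × ℝ => Real.cos p.2)
      (by fun_prop)
  have hs : DifferentiableAt ℝ (fun p : ℝ × ℝ => (Real.sin p.2 : ℂ)) (r, φ) :=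
    Complex.ofRealCLM.differentiableAt.comp (r, φ) (f := fun p : ℝ × ℝ => Real.sin p.2)
      (by fun_prop)
  have hr : DifferentiableAt ℝ (fun p : ℝ × ℝ => (p.1 : ℂ)) (r, φ) :=
    Complex.ofRealCLM.differentiableAt.comp (r, φ) (f := fun p : ℝ × ℝ => p.1)
      (by fun_prop)
  have hMr : HasDerivAt (fun r => M (r, φ)) (fderiv ℝ M (r, φ) (1, 0)) r :=
    HasFDerivAt.comp_hasDerivAt r (f := fun x => (x, φ)) hM.hasFDerivAt
      ((hasDerivAt_id r).prodMk (hasDerivAt_const r φ))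
  have hMφ : HasDerivAt (fun φ => M (r, φ)) (fderiv ℝ M (r, φ) (0, 1)) φ :=
    HasFDerivAt.comp_hasDerivAt φ (f := fun x => (r, x)) hM.hasFDerivAt
      ((hasDerivAt_const φ r).prodMk (hasDerivAt_id φ))
  have hcd : HasDerivAt (fun φ : ℝ => (Real.cos φ : ℂ)) ((-Real.sin φ : ℝ) : ℂ) φ :=
    (Real.hasDerivAt_cos φ).ofReal_comp
  have hsd : HasDerivAt (fun φ : ℝ => (Real.sin φ : ℂ)) ((Real.cos φ : ℝ) : ℂ) φ :=
    (Real.hasDerivAt_sin φ).ofReal_comp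
  have hrd : HasDerivAt (fun r : ℝ => (r : ℂ)) ((1 : ℝ) : ℂ) r := (hasDerivAt_id r).ofReal_comp
  rw [fderiv_apply_fst (hM.fun_mul (hr.fun_mul ((hc.fun_mul hP').fun_add (hs.fun_mul hQ'))))
      (hMr.mul (hrd.mul (((hasDerivAt_polar_radial hP).const_mul (Real.cos φ : ℂ)).add
        ((hasDerivAt_polar_radial hQ).const_mul (Real.sin φ : ℂ))))),
    fderiv_apply_snd (hM.fun_mul ((hs.fun_neg.fun_mul hP').fun_add (hc.fun_mul hQ')))
      (hMφ.mul ((hsd.neg.mul (hasDerivAt_polar_angular hP)).add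
        (hcd.mul (hasDerivAt_polar_angular hQ))))]
  have hcs : (Real.cos φ : ℂ) ^ 2 + (Real.sin φ : ℂ) ^ 2 = 1 := by
    exact_mod_cast Real.cos_sq_add_sin_sq φ
  simp only [Pi.neg_apply, Complex.ofReal_neg, Complex.ofReal_one]
  linear_combination (r * M (r, φ) * (fderiv ℝ P (r * Real.cos φ, r * Real.sin φ) (1, 0) +
        fderiv ℝ Q (r * Real.cos φ, r * Real.sin φ) (0, 1))) * hcs

theorem contDiff_polar :
    ContDiff ℝ 1 fun p : ℝ × ℝ => (p.1 * Real.cos p.2, p.1 * Real.sin p.2) := by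
  fun_prop

theorem contDiffOn_comp_polar {P : ℝ × ℝ → ℂ} {N : Set (ℝ × ℝ)} (hP : ContDiffOn ℝ 1 P N) :
    ContDiffOn ℝ 1 (fun p : ℝ × ℝ => P (p.1 * Real.cos p.2, p.1 * Real.sin p.2))
      ((fun p : ℝ × ℝ => (p.1 * Real.cos p.2, p.1 * Real.sin p.2)) ⁻¹' N) :=
  hP.comp contDiff_polar.contDiffOn fun _ hp => hp

theorem contDiff_ofReal_comp {E : Type*} [NormedAddCommGroup E] [NormedSpace ℝ E] {f : E → ℝ}
    (hf : ContDiff ℝ 1 f) : ContDiff ℝ 1 fun x => (f x : ℂ) :=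
  Complex.ofRealCLM.contDiff.comp hf

theorem contDiffOn_radialPart {P Q : ℝ × ℝ → ℂ} {N : Set (ℝ × ℝ)} (hP : ContDiffOn ℝ 1 P N)
    (hQ : ContDiffOn ℝ 1 Q N) : ContDiffOn ℝ 1 (radialPart P Q)
      ((fun p : ℝ × ℝ => (p.1 * Real.cos p.2, p.1 * Real.sin p.2)) ⁻¹' N) :=
  ((contDiff_ofReal_comp (by fun_prop)).contDiffOn.mul (contDiffOn_comp_polar hP)).add
    ((contDiff_ofReal_comp (by fun_prop)).contDiffOn.mul (contDiffOn_comp_polar hQ))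

theorem contDiffOn_angularPart {P Q : ℝ × ℝ → ℂ} {N : Set (ℝ × ℝ)} (hP : ContDiffOn ℝ 1 P N)
    (hQ : ContDiffOn ℝ 1 Q N) : ContDiffOn ℝ 1 (angularPart P Q)
      ((fun p : ℝ × ℝ => (p.1 * Real.cos p.2, p.1 * Real.sin p.2)) ⁻¹' N) :=
  ((contDiff_ofReal_comp (f := fun p : ℝ × ℝ => Real.sin p.2) (by fun_prop)).neg.contDiffOn.mul
    (contDiffOn_comp_polar hP)).add
    ((contDiff_ofReal_comp (by fun_prop)).contDiffOn.mul (contDiffOn_comp_polar hQ))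

theorem rectangle_subset_polar_preimage {N : Set (ℝ × ℝ)} {r₀ r₁ : ℝ} (h₀ : 0 ≤ r₀)
    (hsub : ∀ q : ℝ × ℝ, r₀ ^ 2 ≤ q.1 ^ 2 + q.2 ^ 2 → q.1 ^ 2 + q.2 ^ 2 ≤ r₁ ^ 2 → q ∈ N) :
    Icc r₀ r₁ ×ˢ Icc (-Real.pi) Real.pi ⊆
      (fun p : ℝ × ℝ => (p.1 * Real.cos p.2, p.1 * Real.sin p.2)) ⁻¹' N := by
  rintro p ⟨⟨h1, h2⟩, -⟩
  have hsq : (p.1 * Real.cos p.2) ^ 2 + (p.1 * Real.sin p.2) ^ 2 = p.1 ^ 2 := by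
    linear_combination p.1 ^ 2 * Real.cos_sq_add_sin_sq p.2
  exact hsub _ (by rw [hsq]; gcongr) (by rw [hsq]; gcongr; exact h₀.trans h1)

/-- The divergence theorem on an annulus, in polar coordinates, for the field `M • (P, Q)`. -/
theorem setIntegral_polar_divergence_mul {P Q M : ℝ × ℝ → ℂ} {N : Set (ℝ × ℝ)} (hN : IsOpen N)
    (hP : ContDiffOn ℝ 1 P N) (hQ : ContDiffOn ℝ 1 Q N) (hM : ContDiff ℝ 1 M)
    (hper : ∀ r, M (r, Real.pi) = M (r, -Real.pi)) {r₀ r₁ : ℝ} (h₀ : 0 ≤ r₀) (hr : r₀ ≤ r₁)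
    (hsub : ∀ q : ℝ × ℝ, r₀ ^ 2 ≤ q.1 ^ 2 + q.2 ^ 2 → q.1 ^ 2 + q.2 ^ 2 ≤ r₁ ^ 2 → q ∈ N) :
    (∫ p in Icc r₀ r₁ ×ˢ Icc (-Real.pi) Real.pi,
      (p.1 * (M p * (fderiv ℝ P (p.1 * Real.cos p.2, p.1 * Real.sin p.2) (1, 0) +
        fderiv ℝ Q (p.1 * Real.cos p.2, p.1 * Real.sin p.2) (0, 1))) +
      (fderiv ℝ M p (1, 0) * (p.1 * radialPart P Q p) +
        fderiv ℝ M p (0, 1) * angularPart P Q p))) =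
      (∫ φ in -Real.pi..Real.pi, M (r₁, φ) * (r₁ * radialPart P Q (r₁, φ))) -
        ∫ φ in -Real.pi..Real.pi, M (r₀, φ) * (r₀ * radialPart P Q (r₀, φ)) := by
  have hΩ := hN.preimage contDiff_polar.continuous
  have hsub' := rectangle_subset_polar_preimage h₀ hsub
  have key := setIntegral_divergence_rectangle hΩ
    (hM.contDiffOn.mul ((contDiff_ofReal_comp (f := fun p : ℝ × ℝ => p.1)
      (by fun_prop)).contDiffOn.mul (contDiffOn_radialPart hP hQ)))
    (hM.contDiffOn.mul (contDiffOn_angularPart hP hQ)) hr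
    (neg_le_self Real.pi_pos.le) hsub'
  have hBper : ∀ r, M (r, Real.pi) * angularPart P Q (r, Real.pi) =
      M (r, -Real.pi) * angularPart P Q (r, -Real.pi) := fun r => by
    simp [hper, angularPart]
  simp only [hBper, sub_self, zero_add] at key
  rw [← key]
  refine setIntegral_congr_fun (measurableSet_Icc.prod measurableSet_Icc) fun p hp => ?_
  exact (polar_divergence_mul
    ((hP.differentiableOn one_ne_zero).differentiableAt (hN.mem_nhds (hsub' hp)))
    ((hQ.differentiableOn one_ne_zero).differentiableAt (hN.mem_nhds (hsub' hp)))
    (hM.differentiable one_ne_zero p)).symm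

/-- The divergence theorem on an annulus centered at the origin (a disk if `r₀ = 0`). -/
theorem setIntegral_annulus_divergence {P Q : ℝ × ℝ → ℂ} {N : Set (ℝ × ℝ)} (hN : IsOpen N)
    (hP : ContDiffOn ℝ 1 P N) (hQ : ContDiffOn ℝ 1 Q N) {r₀ r₁ : ℝ} (h₀ : 0 ≤ r₀) (hr : r₀ < r₁)
    (hsub : ∀ q : ℝ × ℝ, r₀ ^ 2 ≤ q.1 ^ 2 + q.2 ^ 2 → q.1 ^ 2 + q.2 ^ 2 ≤ r₁ ^ 2 → q ∈ N) :
    (∫ q in {q : ℝ × ℝ | r₀ ^ 2 ≤ q.1 ^ 2 + q.2 ^ 2 ∧ q.1 ^ 2 + q.2 ^ 2 < r₁ ^ 2},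
      (fderiv ℝ P q (1, 0) + fderiv ℝ Q q (0, 1))) =
      r₁ * (∫ φ in -Real.pi..Real.pi, radialPart P Q (r₁, φ)) -
        r₀ * ∫ φ in -Real.pi..Real.pi, radialPart P Q (r₀, φ) := by
  rw [setIntegral_annulus_eq_polar _ h₀ hr]
  have := setIntegral_polar_divergence_mul (M := fun _ => 1) hN hP hQ contDiff_const
    (fun _ => rfl) h₀ hr.le hsub
  simpa [intervalIntegral.integral_const_mul, mul_add] using this

/-- Pairing a periodic function `g` of mean zero, with antiderivative `G`, with the trace of `W`
on a circle. -/
theorem setIntegral_polar_trace {W : ℝ × ℝ → ℂ} {N : Set (ℝ × ℝ)} (hN : IsOpen N)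
    (hW : ContDiffOn ℝ 1 W N) {g G : ℝ → ℂ} (hg : ContDiff ℝ 1 g) (hG : ContDiff ℝ 1 G)
    (hGg : ∀ φ, HasDerivAt G (g φ) φ) (hper : G Real.pi = G (-Real.pi)) {a : ℝ} (ha : 0 ≤ a)
    (hsub : ∀ q : ℝ × ℝ, q.1 ^ 2 + q.2 ^ 2 ≤ a ^ 2 → q ∈ N) :
    (∫ p in Icc 0 a ×ˢ Icc (-Real.pi) Real.pi,
      (p.1 * (g p.2 *
        radialPart (fun q => fderiv ℝ W q (1, 0)) (fun q => fderiv ℝ W q (0, 1)) p +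
      -G p.2 * angularPart (fun q => fderiv ℝ W q (1, 0)) (fun q => fderiv ℝ W q (0, 1)) p))) =
      a * ∫ φ in -Real.pi..Real.pi, g φ * W (a * Real.cos φ, a * Real.sin φ) := by
  have hΩ := hN.preimage contDiff_polar.continuous
  have hsub' : Icc 0 a ×ˢ Icc (-Real.pi) Real.pi ⊆ _ :=
    rectangle_subset_polar_preimage le_rfl fun q _ => hsub q
  have hr : ContDiff ℝ 1 fun p : ℝ × ℝ => (p.1 : ℂ) := contDiff_ofReal_comp (by fun_prop)
  have hg2 : ContDiff ℝ 1 fun p : ℝ × ℝ => g p.2 := hg.comp contDiff_snd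
  have hG2 : ContDiff ℝ 1 fun p : ℝ × ℝ => G p.2 := hG.comp contDiff_snd
  have hWp := contDiffOn_comp_polar hW
  have hA := (hr.mul hg2).contDiffOn.mul hWp
  have hB := hG2.neg.contDiffOn.mul hWp
  have key := setIntegral_divergence_rectangle hΩ hA hB ha (neg_le_self Real.pi_pos.le) hsub'
  simp only [hper, Real.cos_neg, Real.sin_neg, Real.cos_pi, Real.sin_pi, neg_zero, sub_self,
    zero_add, Complex.ofReal_zero, zero_mul, intervalIntegral.integral_zero, sub_zero] at key
  simp only [mul_assoc, intervalIntegral.integral_const_mul] at key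
  rw [← key]
  refine setIntegral_congr_fun (measurableSet_Icc.prod measurableSet_Icc) fun p hp => ?_
  have hWd : DifferentiableAt ℝ W (p.1 * Real.cos p.2, p.1 * Real.sin p.2) :=
    (hW.differentiableOn one_ne_zero).differentiableAt (hN.mem_nhds (hsub' hp))
  have hnhds := hΩ.mem_nhds (hsub' hp)
  have hrd : HasDerivAt (fun r : ℝ => (r : ℂ)) ((1 : ℝ) : ℂ) p.1 := (hasDerivAt_id p.1).ofReal_comp
  have e1 := fderiv_apply_fst ((hA.differentiableOn one_ne_zero).differentiableAt hnhds)
    ((hrd.mul_const (g p.2)).mul (hasDerivAt_polar_radial hWd))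
  have e2 := fderiv_apply_snd ((hB.differentiableOn one_ne_zero).differentiableAt hnhds)
    ((hGg p.2).neg.mul (hasDerivAt_polar_angular hWd))
  simp only [mul_assoc] at e1 e2
  simp only [radialPart, angularPart]
  rw [e1, e2]
  simp only [Pi.neg_apply, Complex.ofReal_one]
  ring

theorem normSq_radialPart_add_normSq_angularPart (P Q : ℝ × ℝ → ℂ) (p : ℝ × ℝ) :
    ‖radialPart P Q p‖ ^ 2 + ‖angularPart P Q p‖ ^ 2 =
      ‖P (p.1 * Real.cos p.2, p.1 * Real.sin p.2)‖ ^ 2 +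
        ‖Q (p.1 * Real.cos p.2, p.1 * Real.sin p.2)‖ ^ 2 := by
  unfold radialPart angularPart
  generalize P (p.1 * Real.cos p.2, p.1 * Real.sin p.2) = z
  generalize Q (p.1 * Real.cos p.2, p.1 * Real.sin p.2) = w
  simp only [← Complex.normSq_eq_norm_sq, Complex.normSq_apply, Complex.add_re, Complex.add_im,
    Complex.re_ofReal_mul, Complex.im_ofReal_mul, neg_mul, Complex.neg_re, Complex.neg_im]
  linear_combination (z.re ^ 2 + z.im ^ 2 + w.re ^ 2 + w.im ^ 2) * Real.cos_sq_add_sin_sq p.2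

theorem young_mul_le {δ : ℝ} (hδ : 0 < δ) (x y : ℝ) :
    x * y ≤ δ / 2 * y ^ 2 + 1 / (2 * δ) * x ^ 2 := by
  have : δ / 2 * y ^ 2 + 1 / (2 * δ) * x ^ 2 - x * y = (δ * y - x) ^ 2 / (2 * δ) := by
    field_simp; ring
  have h2 : 0 ≤ (δ * y - x) ^ 2 / (2 * δ) := by positivity
  linarith

theorem norm_setIntegral_polar_pairing_le {P Q : ℝ × ℝ → ℂ} {N : Set (ℝ × ℝ)}
    (hP : ContDiffOn ℝ 1 P N) (hQ : ContDiffOn ℝ 1 Q N) {α β : ℝ → ℂ} (hα : Continuous α)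
    (hβ : Continuous β) {a δ : ℝ} (ha : 0 < a) (hδ : 0 < δ)
    (hsub : ∀ q : ℝ × ℝ, q.1 ^ 2 + q.2 ^ 2 ≤ a ^ 2 → q ∈ N) :
    ‖∫ p in Icc 0 a ×ˢ Icc (-Real.pi) Real.pi,
      (p.1 * (α p.2 * radialPart P Q p + β p.2 * angularPart P Q p) : ℂ)‖ ≤
      δ / 2 * (∫ q in {q : ℝ × ℝ | q.1 ^ 2 + q.2 ^ 2 < a ^ 2}, (‖P q‖ ^ 2 + ‖Q q‖ ^ 2)) +
        a ^ 2 / (4 * δ) * ∫ φ in -Real.pi..Real.pi, (‖α φ‖ ^ 2 + ‖β φ‖ ^ 2) := by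
  have hsub' : Icc 0 a ×ˢ Icc (-Real.pi) Real.pi ⊆ _ :=
    rectangle_subset_polar_preimage le_rfl fun q _ => hsub q
  have hK : IsCompact (Icc 0 a ×ˢ Icc (-Real.pi) Real.pi : Set (ℝ × ℝ)) :=
    isCompact_Icc.prod isCompact_Icc
  have hPp := (contDiffOn_comp_polar hP).continuousOn.mono hsub'
  have hQp := (contDiffOn_comp_polar hQ).continuousOn.mono hsub'
  have hi1 : IntegrableOn (fun p : ℝ × ℝ => p.1 *
      (‖P (p.1 * Real.cos p.2, p.1 * Real.sin p.2)‖ ^ 2 +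
        ‖Q (p.1 * Real.cos p.2, p.1 * Real.sin p.2)‖ ^ 2))
      (Icc 0 a ×ˢ Icc (-Real.pi) Real.pi) :=
    (continuousOn_fst.mul ((hPp.norm.pow 2).add (hQp.norm.pow 2))).integrableOn_compact hK
  have hi2 : IntegrableOn (fun p : ℝ × ℝ => p.1 * (‖α p.2‖ ^ 2 + ‖β p.2‖ ^ 2))
      (Icc 0 a ×ˢ Icc (-Real.pi) Real.pi) :=
    (Continuous.continuousOn (by fun_prop)).integrableOn_compact hK
  have hdisk : (∫ q in {q : ℝ × ℝ | q.1 ^ 2 + q.2 ^ 2 < a ^ 2}, (‖P q‖ ^ 2 + ‖Q q‖ ^ 2)) =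
      ∫ p in Icc 0 a ×ˢ Icc (-Real.pi) Real.pi, p.1 *
      (‖P (p.1 * Real.cos p.2, p.1 * Real.sin p.2)‖ ^ 2 +
        ‖Q (p.1 * Real.cos p.2, p.1 * Real.sin p.2)‖ ^ 2) := by
    have := setIntegral_annulus_eq_polar (fun q => ‖P q‖ ^ 2 + ‖Q q‖ ^ 2) le_rfl ha
    simp only [smul_eq_mul] at this
    rw [← this]
    congr 2
    ext q
    simp only [mem_ofPred_eq]
    exact ⟨fun h => ⟨by rw [zero_pow two_ne_zero]; positivity, h⟩, fun h => h.2⟩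
  have hcircle : (∫ p in Icc 0 a ×ˢ Icc (-Real.pi) Real.pi,
      p.1 * (‖α p.2‖ ^ 2 + ‖β p.2‖ ^ 2)) =
      a ^ 2 / 2 * ∫ φ in -Real.pi..Real.pi, (‖α φ‖ ^ 2 + ‖β φ‖ ^ 2) := by
    rw [Measure.volume_eq_prod, setIntegral_prod_mul (fun r : ℝ => r)
      (fun φ => ‖α φ‖ ^ 2 + ‖β φ‖ ^ 2), integral_Icc_eq_integral_Ioc, integral_Icc_eq_integral_Ioc,
      ← intervalIntegral.integral_of_le ha.le,
      ← intervalIntegral.integral_of_le (neg_le_self Real.pi_pos.le), integral_id]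
    ring
  calc _ ≤ ∫ p in Icc 0 a ×ˢ Icc (-Real.pi) Real.pi,
        (δ / 2 * (p.1 * (‖P (p.1 * Real.cos p.2, p.1 * Real.sin p.2)‖ ^ 2 +
          ‖Q (p.1 * Real.cos p.2, p.1 * Real.sin p.2)‖ ^ 2)) +
          1 / (2 * δ) * (p.1 * (‖α p.2‖ ^ 2 + ‖β p.2‖ ^ 2))) := by
        refine norm_integral_le_of_norm_le ((hi1.const_mul _).add (hi2.const_mul _)) ?_
        refine (ae_restrict_iff' hK.measurableSet).2 (Filter.Eventually.of_forall fun p hp => ?_)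
        have hp0 : 0 ≤ p.1 := hp.1.1
        have h1 := young_mul_le hδ ‖α p.2‖ ‖radialPart P Q p‖
        have h2 := young_mul_le hδ ‖β p.2‖ ‖angularPart P Q p‖
        have h3 : ‖α p.2 * radialPart P Q p + β p.2 * angularPart P Q p‖ ≤
            δ / 2 * (‖radialPart P Q p‖ ^ 2 + ‖angularPart P Q p‖ ^ 2) +
              1 / (2 * δ) * (‖α p.2‖ ^ 2 + ‖β p.2‖ ^ 2) := by
          refine (norm_add_le _ _).trans ?_
          rw [norm_mul, norm_mul]
          linarith
        rw [normSq_radialPart_add_normSq_angularPart] at h3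
        rw [norm_mul, Complex.norm_real, Real.norm_of_nonneg hp0]
        refine (mul_le_mul_of_nonneg_left h3 hp0).trans_eq (by ring)
    _ = _ := by
        rw [integral_add (hi1.const_mul _) (hi2.const_mul _), integral_const_mul,
          integral_const_mul, hdisk, hcircle]
        ring

theorem exists_radial_cutoff {s t : ℝ} (hs : 0 ≤ s) (hst : s < t) :
    ∃ χ : ℝ × ℝ → ℝ, ContDiff ℝ 1 χ ∧ (∀ q, q.1 ^ 2 + q.2 ^ 2 ≤ s ^ 2 → χ q = 1) ∧
      ∀ q, t ^ 2 ≤ q.1 ^ 2 + q.2 ^ 2 → χ q = 0 := by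
  have hpos : 0 < t ^ 2 - s ^ 2 := by nlinarith
  refine ⟨fun q => Real.smoothTransition ((t ^ 2 - (q.1 ^ 2 + q.2 ^ 2)) / (t ^ 2 - s ^ 2)),
    (Real.smoothTransition.contDiff (n := 1)).comp (by fun_prop), fun q hq => ?_, fun q hq => ?_⟩
  · exact Real.smoothTransition.one_of_one_le ((one_le_div hpos).2 (by linarith))
  · exact Real.smoothTransition.zero_of_nonpos
      (div_nonpos_of_nonpos_of_nonneg (by linarith) hpos.le)

theorem isCompact_cell (τ₁ τ₂ : ℝ) : IsCompact (cell τ₁ τ₂) := isCompact_Icc.prod isCompact_Icc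

theorem isCompact_cell_inter_exterior (τ₁ τ₂ a : ℝ) :
    IsCompact (cell τ₁ τ₂ ∩ {q | a ^ 2 ≤ q.1 ^ 2 + q.2 ^ 2}) :=
  (isCompact_cell τ₁ τ₂).inter_right (isClosed_le (by fun_prop) (by fun_prop))

theorem mem_cell_of_normSq_le {τ₁ τ₂ b : ℝ} (hb : 0 ≤ b) (h₁ : b ≤ τ₁ / 2) (h₂ : b ≤ τ₂ / 2)
    {q : ℝ × ℝ} (hq : q.1 ^ 2 + q.2 ^ 2 ≤ b ^ 2) : q ∈ cell τ₁ τ₂ := by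
  have hx := abs_le.1 (abs_le_of_sq_le_sq (show q.1 ^ 2 ≤ b ^ 2 by nlinarith [sq_nonneg q.2]) hb)
  have hy := abs_le.1 (abs_le_of_sq_le_sq (show q.2 ^ 2 ≤ b ^ 2 by nlinarith [sq_nonneg q.1]) hb)
  exact ⟨⟨by linarith, by linarith⟩, ⟨by linarith, by linarith⟩⟩

theorem integrableOn_divergence {P Q : ℝ × ℝ → ℂ} {N K : Set (ℝ × ℝ)} (hN : IsOpen N)
    (hP : ContDiffOn ℝ 1 P N) (hQ : ContDiffOn ℝ 1 Q N) (hK : IsCompact K) (hKN : K ⊆ N) :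
    IntegrableOn (fun q => fderiv ℝ P q (1, 0) + fderiv ℝ Q q (0, 1)) K :=
  ((((hP.continuousOn_fderiv_of_isOpen hN le_rfl).clm_apply continuousOn_const).add
    ((hQ.continuousOn_fderiv_of_isOpen hN le_rfl).clm_apply continuousOn_const)).mono
      hKN).integrableOn_compact hK

/-- The divergence theorem on the fundamental cell with a disk removed, for periodic fields. -/
theorem setIntegral_exterior_divergence {P Q : ℝ × ℝ → ℂ} {N : Set (ℝ × ℝ)} (hN : IsOpen N)
    (hP : ContDiffOn ℝ 1 P N) (hQ : ContDiffOn ℝ 1 Q N) {τ₁ τ₂ a : ℝ} (ha : 0 < a)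
    (h₁ : a < τ₁ / 2) (h₂ : a < τ₂ / 2)
    (hsub : ∀ q ∈ cell τ₁ τ₂, a ^ 2 ≤ q.1 ^ 2 + q.2 ^ 2 → q ∈ N)
    (hPper : ∀ y ∈ Icc (-τ₂ / 2) (τ₂ / 2), P (τ₁ / 2, y) = P (-τ₁ / 2, y))
    (hQper : ∀ x ∈ Icc (-τ₁ / 2) (τ₁ / 2), Q (x, τ₂ / 2) = Q (x, -τ₂ / 2)) :
    (∫ q in cell τ₁ τ₂ ∩ {q | a ^ 2 ≤ q.1 ^ 2 + q.2 ^ 2},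
      (fderiv ℝ P q (1, 0) + fderiv ℝ Q q (0, 1))) =
      -(a * ∫ φ in -Real.pi..Real.pi, radialPart P Q (a, φ)) := by
  obtain ⟨b, hab, hb⟩ := exists_between (lt_min h₁ h₂)
  obtain ⟨t, hat, htb⟩ := exists_between hab
  obtain ⟨s, has, hst⟩ := exists_between hat
  obtain ⟨hb₁, hb₂⟩ := lt_min_iff.1 hb
  have hs : 0 < s := ha.trans has
  obtain ⟨χ, hχ, hχ1, hχ0⟩ := exists_radial_cutoff hs.le hst
  have hχc : ContDiff ℝ 1 fun q => (χ q : ℂ) := contDiff_ofReal_comp hχ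
  set T := cell τ₁ τ₂ ∩ {q : ℝ × ℝ | a ^ 2 ≤ q.1 ^ 2 + q.2 ^ 2} with hT
  have hTc : IsCompact T := isCompact_cell_inter_exterior τ₁ τ₂ a
  have hTN : T ⊆ N := fun q hq => hsub q hq.1 hq.2
  have hopen : IsOpen {q : ℝ × ℝ | q.1 ^ 2 + q.2 ^ 2 < s ^ 2} :=
    isOpen_lt (by fun_prop) (by fun_prop)
  have hopen' : IsOpen {q : ℝ × ℝ | t ^ 2 < q.1 ^ 2 + q.2 ^ 2} :=
    isOpen_lt (by fun_prop) (by fun_prop)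
  have hin : ∀ (F : ℝ × ℝ → ℂ) (q : ℝ × ℝ), q.1 ^ 2 + q.2 ^ 2 < s ^ 2 →
      (fun q => (1 - (χ q : ℂ)) * F q) =ᶠ[nhds q] fun _ => 0 := fun F q hq => by
    filter_upwards [hopen.mem_nhds hq] with z hz
    simp [hχ1 z (le_of_lt hz)]
  have hout : ∀ (F : ℝ × ℝ → ℂ) (q : ℝ × ℝ), t ^ 2 < q.1 ^ 2 + q.2 ^ 2 →
      (fun q => (χ q : ℂ) * F q) =ᶠ[nhds q] fun _ => 0 := fun F q hq => by
    filter_upwards [hopen'.mem_nhds hq] with z hz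
    simp [hχ0 z (le_of_lt hz)]
  have hfar : ∀ {F : ℝ × ℝ → ℂ}, ContDiffOn ℝ 1 F N → ContDiffOn ℝ 1
      (fun q => (1 - (χ q : ℂ)) * F q) (N ∪ {q | q.1 ^ 2 + q.2 ^ 2 < s ^ 2}) := by
    intro F hF q hq
    refine ContDiffAt.contDiffWithinAt ?_
    rcases hq with hq | hq
    · exact (contDiff_const.sub hχc).contDiffAt.mul (hF.contDiffAt (hN.mem_nhds hq))
    · exact contDiffAt_const.congr_of_eventuallyEq (hin F q hq)
  have hnear : ∀ {F : ℝ × ℝ → ℂ}, ContDiffOn ℝ 1 F N →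
      ContDiffOn ℝ 1 (fun q => (χ q : ℂ) * F q) N := fun hF => hχc.contDiffOn.mul hF
  have hcell : cell τ₁ τ₂ ⊆ N ∪ {q | q.1 ^ 2 + q.2 ^ 2 < s ^ 2} := fun q hq => by
    rcases le_or_gt (a ^ 2) (q.1 ^ 2 + q.2 ^ 2) with h | h
    · exact Or.inl (hsub q hq h)
    · exact Or.inr (h.trans (by gcongr))
  have hχ0x : ∀ x y : ℝ, x ^ 2 = (τ₁ / 2) ^ 2 → χ (x, y) = 0 := fun x y hx =>
    hχ0 _ (by simp only [hx]; nlinarith [sq_nonneg y])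
  have hχ0y : ∀ x y : ℝ, y ^ 2 = (τ₂ / 2) ^ 2 → χ (x, y) = 0 := fun x y hy =>
    hχ0 _ (by simp only [hy]; nlinarith [sq_nonneg x])
  have hsplit : ∀ {F : ℝ × ℝ → ℂ}, ContDiffOn ℝ 1 F N → ∀ q ∈ N, fderiv ℝ F q =
      fderiv ℝ (fun q => (1 - (χ q : ℂ)) * F q) q + fderiv ℝ (fun q => (χ q : ℂ) * F q) q := by
    intro F hF q hq
    have hsum : F = fun q => (1 - (χ q : ℂ)) * F q + (χ q : ℂ) * F q := by ext; ring
    conv_lhs => rw [hsum]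
    exact fderiv_fun_add
      (((hfar hF).differentiableOn one_ne_zero).differentiableAt
        ((hN.union hopen).mem_nhds (Or.inl hq)))
      (((hnear hF).differentiableOn one_ne_zero).differentiableAt (hN.mem_nhds hq))
  have hcellint : (∫ q in cell τ₁ τ₂, (fderiv ℝ (fun q => (1 - (χ q : ℂ)) * P q) q (1, 0) +
      fderiv ℝ (fun q => (1 - (χ q : ℂ)) * Q q) q (0, 1))) = 0 := by
    rw [cell, setIntegral_divergence_rectangle (hN.union hopen) (hfar hP) (hfar hQ)
      (by linarith) (by linarith) hcell]
    have e1 : (∫ x in (-τ₁ / 2)..(τ₁ / 2), (1 - (χ (x, τ₂ / 2) : ℂ)) * Q (x, τ₂ / 2)) =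
        ∫ x in (-τ₁ / 2)..(τ₁ / 2), (1 - (χ (x, -τ₂ / 2) : ℂ)) * Q (x, -τ₂ / 2) := by
      refine intervalIntegral.integral_congr fun x hx => ?_
      rw [uIcc_of_le (by linarith)] at hx
      simp only [hQper x hx, hχ0y x (τ₂ / 2) rfl, hχ0y x (-τ₂ / 2) (by ring)]
    have e2 : (∫ y in (-τ₂ / 2)..(τ₂ / 2), (1 - (χ (τ₁ / 2, y) : ℂ)) * P (τ₁ / 2, y)) =
        ∫ y in (-τ₂ / 2)..(τ₂ / 2), (1 - (χ (-τ₁ / 2, y) : ℂ)) * P (-τ₁ / 2, y) := by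
      refine intervalIntegral.integral_congr fun y hy => ?_
      rw [uIcc_of_le (by linarith)] at hy
      simp only [hPper y hy, hχ0x (τ₁ / 2) y rfl, hχ0x (-τ₁ / 2) y (by ring)]
    rw [e1, e2]
    ring
  have hfarint : (∫ q in T, (fderiv ℝ (fun q => (1 - (χ q : ℂ)) * P q) q (1, 0) +
      fderiv ℝ (fun q => (1 - (χ q : ℂ)) * Q q) q (0, 1))) = 0 := by
    rw [← hcellint]
    refine (setIntegral_eq_of_subset_of_forall_sdiff_eq_zero
      (isCompact_cell τ₁ τ₂).measurableSet inter_subset_left fun q hq => ?_).symm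
    have hq' : q.1 ^ 2 + q.2 ^ 2 < s ^ 2 := by
      have : q.1 ^ 2 + q.2 ^ 2 < a ^ 2 := not_le.1 fun h => hq.2 ⟨hq.1, h⟩
      exact this.trans (by gcongr)
    simp [(hin P q hq').fderiv_eq, (hin Q q hq').fderiv_eq]
  have hsubT : ∀ q : ℝ × ℝ, a ^ 2 ≤ q.1 ^ 2 + q.2 ^ 2 → q.1 ^ 2 + q.2 ^ 2 ≤ b ^ 2 → q ∈ T :=
    fun q h h' => ⟨mem_cell_of_normSq_le (ha.trans hab).le hb₁.le hb₂.le h', h⟩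
  have hnearint : (∫ q in T, (fderiv ℝ (fun q => (χ q : ℂ) * P q) q (1, 0) +
      fderiv ℝ (fun q => (χ q : ℂ) * Q q) q (0, 1))) =
      -(a * ∫ φ in -Real.pi..Real.pi, radialPart P Q (a, φ)) := by
    have key := setIntegral_annulus_divergence hN (hnear hP) (hnear hQ) ha.le hab
      fun q h h' => hTN (hsubT q h h')
    have hsq : ∀ r φ : ℝ, (r * Real.cos φ) ^ 2 + (r * Real.sin φ) ^ 2 = r ^ 2 := fun r φ => by
      linear_combination r ^ 2 * Real.cos_sq_add_sin_sq φ
    have hb0 : ∀ φ : ℝ, χ (b * Real.cos φ, b * Real.sin φ) = 0 := fun φ =>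
      hχ0 _ (by rw [hsq]; have := hs.trans hst; gcongr)
    have ha1 : ∀ φ : ℝ, χ (a * Real.cos φ, a * Real.sin φ) = 1 := fun φ =>
      hχ1 _ (by rw [hsq]; gcongr)
    simp only [radialPart, hb0, ha1, Complex.ofReal_zero, Complex.ofReal_one, zero_mul, one_mul,
      mul_zero, add_zero, intervalIntegral.integral_zero, zero_sub] at key
    simp only [radialPart]
    rw [← key]
    refine setIntegral_eq_of_subset_of_forall_sdiff_eq_zero hTc.measurableSet
      (fun q hq => hsubT q hq.1 hq.2.le) fun q hq => ?_
    have hq' : t ^ 2 < q.1 ^ 2 + q.2 ^ 2 := by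
      have : b ^ 2 ≤ q.1 ^ 2 + q.2 ^ 2 := not_lt.1 fun h => hq.2 ⟨hq.1.2, h⟩
      refine lt_of_lt_of_le ?_ this
      have := hs.trans hst
      gcongr
    simp [(hout P q hq').fderiv_eq, (hout Q q hq').fderiv_eq]
  have hadd := integral_add
    (integrableOn_divergence (hN.union hopen) (hfar hP) (hfar hQ) hTc
      (hTN.trans subset_union_left))
    (integrableOn_divergence hN (hnear hP) (hnear hQ) hTc hTN)
  rw [hfarint, hnearint, zero_add] at hadd
  rw [← hadd]
  refine setIntegral_congr_fun hTc.measurableSet fun q hq => ?_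
  simp only [hsplit hP q (hTN hq), hsplit hQ q (hTN hq), add_apply]
  ring

theorem contDiffOn_partial {V : ℝ × ℝ → ℂ} {N : Set (ℝ × ℝ)} (hN : IsOpen N)
    (hV : ContDiffOn ℝ 2 V N) (e : ℝ × ℝ) : ContDiffOn ℝ 1 (fun q => fderiv ℝ V q e) N :=
  (hV.fderiv_of_isOpen hN (by norm_num)).clm_apply contDiffOn_const

theorem contDiffOn_star_comp {V : ℝ × ℝ → ℂ} {N : Set (ℝ × ℝ)} {n : ℕ∞}
    (hV : ContDiffOn ℝ n V N) : ContDiffOn ℝ n (fun q => star (V q)) N :=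
  (starL' ℝ : ℂ ≃L[ℝ] ℂ).contDiff.comp_contDiffOn hV

theorem contDiff_star_comp {f : ℝ → ℂ} {n : ℕ∞} (hf : ContDiff ℝ n f) :
    ContDiff ℝ n fun x => star (f x) :=
  (starL' ℝ : ℂ ≃L[ℝ] ℂ).contDiff.comp hf

theorem divergence_star_mul_gradient {V : ℝ × ℝ → ℂ} {N : Set (ℝ × ℝ)} (hN : IsOpen N)
    (hV : ContDiffOn ℝ 2 V N) {q : ℝ × ℝ} (hq : q ∈ N) (hlap : lap V q = 0) :
    fderiv ℝ (fun q => star (V q) * fderiv ℝ V q (1, 0)) q (1, 0) +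
      fderiv ℝ (fun q => star (V q) * fderiv ℝ V q (0, 1)) q (0, 1) =
      ((‖fderiv ℝ V q (1, 0)‖ ^ 2 + ‖fderiv ℝ V q (0, 1)‖ ^ 2 : ℝ) : ℂ) := by
  have hd : DifferentiableAt ℝ V q :=
    (hV.differentiableOn two_ne_zero).differentiableAt (hN.mem_nhds hq)
  have hd' : ∀ e, DifferentiableAt ℝ (fun q => fderiv ℝ V q e) q := fun e =>
    ((contDiffOn_partial hN hV e).differentiableOn one_ne_zero).differentiableAt (hN.mem_nhds hq)
  have hsd : DifferentiableAt ℝ (fun q => star (V q)) q := hd.star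
  unfold lap at hlap
  rw [fderiv_fun_mul hsd (hd' _), fderiv_fun_mul hsd (hd' _), fderiv_star]
  have hn : ∀ z : ℂ, z * star z = ((‖z‖ ^ 2 : ℝ) : ℂ) := fun z => by
    rw [Complex.ofReal_pow]; exact Complex.mul_conj' z
  simp only [add_apply, smul_apply, smul_eq_mul, ContinuousLinearMap.comp_apply,
    ContinuousLinearEquiv.coe_coe, starL'_apply, hn, Complex.ofReal_add]
  linear_combination star (V q) * hlap

theorem radialPart_star_mul (V P Q : ℝ × ℝ → ℂ) (p : ℝ × ℝ) :
    radialPart (fun q => star (V q) * P q) (fun q => star (V q) * Q q) p =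
      star (V (p.1 * Real.cos p.2, p.1 * Real.sin p.2)) * radialPart P Q p := by
  unfold radialPart; ring

theorem continuous_radialPart {P Q : ℝ × ℝ → ℂ} {N : Set (ℝ × ℝ)} (hP : ContDiffOn ℝ 1 P N)
    (hQ : ContDiffOn ℝ 1 Q N) {a : ℝ} (hsub : ∀ q : ℝ × ℝ, q.1 ^ 2 + q.2 ^ 2 = a ^ 2 → q ∈ N) :
    Continuous fun φ : ℝ => radialPart P Q (a, φ) := by
  refine (contDiffOn_radialPart hP hQ).continuousOn.comp_continuous (by fun_prop) fun φ => ?_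
  exact hsub _ (by linear_combination a ^ 2 * Real.cos_sq_add_sin_sq φ)

theorem sq_integral_norm_le {g : ℝ → ℂ} (hg : Continuous g) {c d : ℝ} (hcd : c ≤ d) :
    (∫ x in c..d, ‖g x‖) ^ 2 ≤ (d - c) * ∫ x in c..d, ‖g x‖ ^ 2 := by
  rcases hcd.eq_or_lt with rfl | hlt
  · simp
  set I := ∫ x in c..d, ‖g x‖ with hI
  have hpos : 0 < d - c := sub_pos.2 hlt
  have h0 : 0 ≤ ∫ x in c..d, (‖g x‖ - I / (d - c)) ^ 2 :=
    intervalIntegral.integral_nonneg hcd fun x _ => sq_nonneg _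
  have h1 : (∫ x in c..d, (‖g x‖ - I / (d - c)) ^ 2) =
      (∫ x in c..d, ‖g x‖ ^ 2) - 2 * (I / (d - c)) * I + (d - c) * (I / (d - c)) ^ 2 := by
    have hfun : (fun x => (‖g x‖ - I / (d - c)) ^ 2) = fun x =>
        ‖g x‖ ^ 2 - 2 * (I / (d - c)) * ‖g x‖ + (I / (d - c)) ^ 2 := by ext; ring
    rw [hfun, intervalIntegral.integral_add, intervalIntegral.integral_sub,
      intervalIntegral.integral_const_mul, intervalIntegral.integral_const, smul_eq_mul]
    all_goals exact Continuous.intervalIntegrable (by fun_prop) _ _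
  rw [h1] at h0
  have h2 : (d - c) * ((∫ x in c..d, ‖g x‖ ^ 2) - 2 * (I / (d - c)) * I +
      (d - c) * (I / (d - c)) ^ 2) = (d - c) * (∫ x in c..d, ‖g x‖ ^ 2) - I ^ 2 := by
    field_simp; ring
  nlinarith [mul_nonneg hpos.le h0]

/-- A periodic function of mean zero has a periodic antiderivative controlled in `L²`. -/
theorem exists_periodic_antiderivative {g : ℝ → ℂ} (hg : Continuous g)
    (hmean : ∫ φ in -Real.pi..Real.pi, g φ = 0) :
    ∃ G : ℝ → ℂ, (∀ φ, HasDerivAt G (g φ) φ) ∧ G Real.pi = G (-Real.pi) ∧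
      (∫ φ in -Real.pi..Real.pi, ‖G φ‖ ^ 2) ≤
        4 * Real.pi ^ 2 * ∫ φ in -Real.pi..Real.pi, ‖g φ‖ ^ 2 := by
  have hpi : -Real.pi ≤ Real.pi := neg_le_self Real.pi_pos.le
  have hd : ∀ φ, HasDerivAt (fun x => ∫ t in -Real.pi..x, g t) (g φ) φ := fun φ =>
    intervalIntegral.integral_hasDerivAt_right (hg.intervalIntegrable _ _)
      (hg.stronglyMeasurableAtFilter _ _) hg.continuousAt
  refine ⟨fun x => ∫ t in -Real.pi..x, g t, hd, by simp [hmean], ?_⟩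
  have hcont : Continuous fun x => ∫ t in -Real.pi..x, g t :=
    continuous_iff_continuousAt.2 fun φ => (hd φ).continuousAt
  have hbound : ∀ φ ∈ Icc (-Real.pi) Real.pi, ‖∫ t in -Real.pi..φ, g t‖ ^ 2 ≤
      2 * Real.pi * ∫ φ in -Real.pi..Real.pi, ‖g φ‖ ^ 2 := fun φ hφ => by
    have h1 : ‖∫ t in -Real.pi..φ, g t‖ ≤ ∫ t in -Real.pi..Real.pi, ‖g t‖ :=
      (intervalIntegral.norm_integral_le_integral_norm hφ.1).trans
        (intervalIntegral.integral_mono_interval le_rfl hφ.1 hφ.2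
          (Filter.Eventually.of_forall fun _ => norm_nonneg _) (hg.norm.intervalIntegrable _ _))
    have h2 := sq_integral_norm_le hg hpi
    have h3 : Real.pi - -Real.pi = 2 * Real.pi := by ring
    rw [h3] at h2
    exact (pow_le_pow_left₀ (norm_nonneg _) h1 2).trans h2
  have hmono : (∫ φ in -Real.pi..Real.pi, ‖∫ t in -Real.pi..φ, g t‖ ^ 2) ≤
      ∫ _ in -Real.pi..Real.pi, 2 * Real.pi * ∫ φ in -Real.pi..Real.pi, ‖g φ‖ ^ 2 :=
    intervalIntegral.integral_mono_on hpi (Continuous.intervalIntegrable (hcont.norm.pow 2) _ _)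
      (continuous_const.intervalIntegrable _ _) hbound
  refine hmono.trans_eq ?_
  rw [intervalIntegral.integral_const, smul_eq_mul]
  ring

theorem integral_normSq_deriv_le {h : ℝ → ℂ} (hh : ContDiff ℝ 2 h)
    (hper : ∀ φ : ℝ, h (φ + 2 * Real.pi) = h φ) :
    (∫ φ in -Real.pi..Real.pi, ‖deriv h φ‖ ^ 2) ≤
      ((∫ φ in -Real.pi..Real.pi, ‖h φ‖ ^ 2) +
        ∫ φ in -Real.pi..Real.pi, ‖deriv (deriv h) φ‖ ^ 2) / 2 := by
  have hpi : -Real.pi ≤ Real.pi := neg_le_self Real.pi_pos.le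
  have hh1 : ContDiff ℝ 1 (deriv h) := hh.deriv'
  have hc0 : Continuous h := hh.continuous
  have hc1 : Continuous (deriv h) := hh1.continuous
  have hc2 : Continuous (deriv (deriv h)) := hh1.continuous_deriv_one
  have hend : h Real.pi = h (-Real.pi) := by rw [← hper (-Real.pi)]; congr 1; ring
  have hend' : deriv h Real.pi = deriv h (-Real.pi) := by
    have : (fun φ => h (φ + 2 * Real.pi)) = h := funext hper
    conv_rhs => rw [← this, deriv_comp_add_const]
    congr 1; ring
  have hibp := intervalIntegral.integral_mul_deriv_eq_deriv_mul (a := -Real.pi) (b := Real.pi)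
    (u := deriv h) (v := fun φ => star (h φ)) (u' := deriv (deriv h))
    (v' := fun φ => star (deriv h φ))
    (fun φ _ => (hh1.differentiable one_ne_zero φ).hasDerivAt)
    (fun φ _ => (hh.differentiable two_ne_zero φ).hasDerivAt.star)
    (hc2.intervalIntegrable _ _) (hc1.star.intervalIntegrable _ _)
  have hn : ∀ z : ℂ, z * star z = ((‖z‖ ^ 2 : ℝ) : ℂ) := fun z => by
    rw [Complex.ofReal_pow]; exact Complex.mul_conj' z
  simp only [hn, hend, hend', sub_self, zero_sub] at hibp
  rw [intervalIntegral.integral_ofReal] at hibp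
  have hnorm := congrArg norm hibp
  rw [Complex.norm_real, Real.norm_of_nonneg
    (intervalIntegral.integral_nonneg hpi fun _ _ => sq_nonneg _), norm_neg] at hnorm
  have hi0 : IntervalIntegrable (fun φ => ‖h φ‖ ^ 2) volume (-Real.pi) Real.pi :=
    Continuous.intervalIntegrable (by fun_prop) _ _
  have hi2 : IntervalIntegrable (fun φ => ‖deriv (deriv h) φ‖ ^ 2) volume (-Real.pi) Real.pi :=
    Continuous.intervalIntegrable (by fun_prop) _ _
  rw [hnorm, ← intervalIntegral.integral_add hi0 hi2, ← intervalIntegral.integral_div]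
  refine (intervalIntegral.norm_integral_le_integral_norm hpi).trans
    (intervalIntegral.integral_mono_on hpi ((hc2.mul hc0.star).norm.intervalIntegrable _ _)
      (Continuous.intervalIntegrable (by fun_prop) _ _) fun φ _ => ?_)
  rw [norm_mul, norm_star]
  nlinarith [sq_nonneg (‖h φ‖ - ‖deriv (deriv h) φ‖)]

/-- The squared length of the gradient of `V`. -/
noncomputable def gradSq (V : ℝ × ℝ → ℂ) (q : ℝ × ℝ) : ℝ :=
  ‖fderiv ℝ V q (1, 0)‖ ^ 2 + ‖fderiv ℝ V q (0, 1)‖ ^ 2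

/-- The radial derivative of `V` at the point with polar coordinates `(a, φ)`. -/
noncomputable def normalDeriv (V : ℝ × ℝ → ℂ) (a φ : ℝ) : ℂ :=
  radialPart (fun q => fderiv ℝ V q (1, 0)) (fun q => fderiv ℝ V q (0, 1)) (a, φ)

theorem continuous_normalDeriv {V : ℝ × ℝ → ℂ} {N : Set (ℝ × ℝ)} (hN : IsOpen N)
    (hV : ContDiffOn ℝ 2 V N) {a : ℝ}
    (hsub : ∀ q : ℝ × ℝ, q.1 ^ 2 + q.2 ^ 2 = a ^ 2 → q ∈ N) : Continuous (normalDeriv V a) :=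
  continuous_radialPart (contDiffOn_partial hN hV _) (contDiffOn_partial hN hV _) hsub

theorem continuous_comp_circle {V : ℝ × ℝ → ℂ} {N : Set (ℝ × ℝ)} (hV : ContinuousOn V N) {a : ℝ}
    (hsub : ∀ q : ℝ × ℝ, q.1 ^ 2 + q.2 ^ 2 = a ^ 2 → q ∈ N) :
    Continuous fun φ : ℝ => V (a * Real.cos φ, a * Real.sin φ) :=
  hV.comp_continuous (by fun_prop) fun φ =>
    hsub _ (by linear_combination a ^ 2 * Real.cos_sq_add_sin_sq φ)

theorem gradSq_star (V : ℝ × ℝ → ℂ) (q : ℝ × ℝ) : gradSq (fun q => star (V q)) q = gradSq V q := by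
  simp only [gradSq, fderiv_star, ContinuousLinearMap.comp_apply, ContinuousLinearEquiv.coe_coe,
    starL'_apply, norm_star]

theorem measurableSet_disk (a : ℝ) : MeasurableSet {q : ℝ × ℝ | q.1 ^ 2 + q.2 ^ 2 < a ^ 2} :=
  (isOpen_lt (by fun_prop) continuous_const).measurableSet

theorem setIntegral_disk_divergence {P Q : ℝ × ℝ → ℂ} {N : Set (ℝ × ℝ)} (hN : IsOpen N)
    (hP : ContDiffOn ℝ 1 P N) (hQ : ContDiffOn ℝ 1 Q N) {a : ℝ} (ha : 0 < a)
    (hsub : ∀ q : ℝ × ℝ, q.1 ^ 2 + q.2 ^ 2 ≤ a ^ 2 → q ∈ N) :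
    (∫ q in {q : ℝ × ℝ | q.1 ^ 2 + q.2 ^ 2 < a ^ 2},
      (fderiv ℝ P q (1, 0) + fderiv ℝ Q q (0, 1))) =
      a * ∫ φ in -Real.pi..Real.pi, radialPart P Q (a, φ) := by
  have h := setIntegral_annulus_divergence hN hP hQ le_rfl ha fun q _ hq => hsub q hq
  have hset : {q : ℝ × ℝ | (0 : ℝ) ^ 2 ≤ q.1 ^ 2 + q.2 ^ 2 ∧ q.1 ^ 2 + q.2 ^ 2 < a ^ 2} =
      {q : ℝ × ℝ | q.1 ^ 2 + q.2 ^ 2 < a ^ 2} := by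
    ext q
    simp only [mem_ofPred_eq, and_iff_right_iff_imp]
    exact fun _ => by nlinarith [sq_nonneg q.1, sq_nonneg q.2]
  rw [hset] at h
  rw [h]; simp

theorem integral_normalDeriv_of_disk {V : ℝ × ℝ → ℂ} {N : Set (ℝ × ℝ)} (hN : IsOpen N)
    (hV : ContDiffOn ℝ 2 V N) {a : ℝ} (ha : 0 < a)
    (hsub : ∀ q : ℝ × ℝ, q.1 ^ 2 + q.2 ^ 2 ≤ a ^ 2 → q ∈ N)
    (hlap : ∀ q : ℝ × ℝ, q.1 ^ 2 + q.2 ^ 2 ≤ a ^ 2 → lap V q = 0) :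
    ∫ φ in -Real.pi..Real.pi, normalDeriv V a φ = 0 := by
  have h := setIntegral_disk_divergence hN (contDiffOn_partial hN hV (1, 0))
    (contDiffOn_partial hN hV (0, 1)) ha hsub
  replace h := h.symm.trans
    (setIntegral_eq_zero_of_forall_eq_zero fun q (hq : _ < _) => hlap q hq.le)
  exact (mul_eq_zero.1 h).resolve_left (by exact_mod_cast ha.ne')

theorem setIntegral_disk_gradSq {V : ℝ × ℝ → ℂ} {N : Set (ℝ × ℝ)} (hN : IsOpen N)
    (hV : ContDiffOn ℝ 2 V N) {a : ℝ} (ha : 0 < a)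
    (hsub : ∀ q : ℝ × ℝ, q.1 ^ 2 + q.2 ^ 2 ≤ a ^ 2 → q ∈ N)
    (hlap : ∀ q : ℝ × ℝ, q.1 ^ 2 + q.2 ^ 2 ≤ a ^ 2 → lap V q = 0) :
    ((∫ q in {q : ℝ × ℝ | q.1 ^ 2 + q.2 ^ 2 < a ^ 2}, gradSq V q : ℝ) : ℂ) =
      a * ∫ φ in -Real.pi..Real.pi,
        star (V (a * Real.cos φ, a * Real.sin φ)) * normalDeriv V a φ := by
  have hV1 : ContDiffOn ℝ 1 (fun q => star (V q)) N :=
    contDiffOn_star_comp (n := 1) (hV.of_le (by norm_num))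
  have h := setIntegral_disk_divergence hN (hV1.mul (contDiffOn_partial hN hV (1, 0)))
    (hV1.mul (contDiffOn_partial hN hV (0, 1))) ha hsub
  simp only [radialPart_star_mul] at h
  refine (integral_ofReal (𝕜 := ℂ)).symm.trans (Eq.trans ?_ h)
  exact setIntegral_congr_fun (measurableSet_disk a) fun q (hq : _ < _) =>
    (divergence_star_mul_gradient hN hV (hsub q hq.le) (hlap q hq.le)).symm

theorem measurableSet_cell_inter_exterior (τ₁ τ₂ a : ℝ) :
    MeasurableSet (cell τ₁ τ₂ ∩ {q | a ^ 2 ≤ q.1 ^ 2 + q.2 ^ 2}) :=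
  (isCompact_cell_inter_exterior τ₁ τ₂ a).measurableSet

theorem integral_normalDeriv_of_exterior {V : ℝ × ℝ → ℂ} {N : Set (ℝ × ℝ)} (hN : IsOpen N)
    (hV : ContDiffOn ℝ 2 V N) {τ₁ τ₂ a : ℝ} (ha : 0 < a) (h₁ : a < τ₁ / 2) (h₂ : a < τ₂ / 2)
    (hsub : ∀ q ∈ cell τ₁ τ₂, a ^ 2 ≤ q.1 ^ 2 + q.2 ^ 2 → q ∈ N)
    (hlap : ∀ q ∈ cell τ₁ τ₂, a ^ 2 ≤ q.1 ^ 2 + q.2 ^ 2 → lap V q = 0)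
    (hx : ∀ y ∈ Icc (-τ₂ / 2) (τ₂ / 2),
      fderiv ℝ V (τ₁ / 2, y) = fderiv ℝ V (-τ₁ / 2, y))
    (hy : ∀ x ∈ Icc (-τ₁ / 2) (τ₁ / 2),
      fderiv ℝ V (x, τ₂ / 2) = fderiv ℝ V (x, -τ₂ / 2)) :
    ∫ φ in -Real.pi..Real.pi, normalDeriv V a φ = 0 := by
  have h := setIntegral_exterior_divergence hN (contDiffOn_partial hN hV (1, 0))
    (contDiffOn_partial hN hV (0, 1)) ha h₁ h₂ hsub (fun y h => by simp only [hx y h])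
    (fun x h => by simp only [hy x h])
  replace h := h.symm.trans
    (setIntegral_eq_zero_of_forall_eq_zero fun q hq => hlap q hq.1 hq.2)
  exact (mul_eq_zero.1 (neg_eq_zero.1 h)).resolve_left (by exact_mod_cast ha.ne')

theorem setIntegral_exterior_gradSq {V : ℝ × ℝ → ℂ} {N : Set (ℝ × ℝ)} (hN : IsOpen N)
    (hV : ContDiffOn ℝ 2 V N) {τ₁ τ₂ a : ℝ} (ha : 0 < a) (h₁ : a < τ₁ / 2) (h₂ : a < τ₂ / 2)
    (hsub : ∀ q ∈ cell τ₁ τ₂, a ^ 2 ≤ q.1 ^ 2 + q.2 ^ 2 → q ∈ N)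
    (hlap : ∀ q ∈ cell τ₁ τ₂, a ^ 2 ≤ q.1 ^ 2 + q.2 ^ 2 → lap V q = 0)
    (hx : ∀ y ∈ Icc (-τ₂ / 2) (τ₂ / 2), V (τ₁ / 2, y) = V (-τ₁ / 2, y) ∧
      fderiv ℝ V (τ₁ / 2, y) = fderiv ℝ V (-τ₁ / 2, y))
    (hy : ∀ x ∈ Icc (-τ₁ / 2) (τ₁ / 2), V (x, τ₂ / 2) = V (x, -τ₂ / 2) ∧
      fderiv ℝ V (x, τ₂ / 2) = fderiv ℝ V (x, -τ₂ / 2)) :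
    ((∫ q in cell τ₁ τ₂ ∩ {q | a ^ 2 ≤ q.1 ^ 2 + q.2 ^ 2}, gradSq V q : ℝ) : ℂ) =
      -(a * ∫ φ in -Real.pi..Real.pi,
        star (V (a * Real.cos φ, a * Real.sin φ)) * normalDeriv V a φ) := by
  have hV1 : ContDiffOn ℝ 1 (fun q => star (V q)) N :=
    contDiffOn_star_comp (n := 1) (hV.of_le (by norm_num))
  have h := setIntegral_exterior_divergence hN (hV1.mul (contDiffOn_partial hN hV (1, 0)))
    (hV1.mul (contDiffOn_partial hN hV (0, 1))) ha h₁ h₂ hsub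
    (fun y h => by simp only [hx y h]) (fun x h => by simp only [hy x h])
  simp only [radialPart_star_mul] at h
  refine (integral_ofReal (𝕜 := ℂ)).symm.trans (Eq.trans ?_ h)
  exact setIntegral_congr_fun (measurableSet_cell_inter_exterior τ₁ τ₂ a) fun q hq =>
    (divergence_star_mul_gradient hN hV (hsub q hq.1 hq.2) (hlap q hq.1 hq.2)).symm

theorem norm_integral_mul_star_circle_le {V : ℝ × ℝ → ℂ} {N : Set (ℝ × ℝ)} (hN : IsOpen N)
    (hV : ContDiffOn ℝ 2 V N) {a δ : ℝ} (ha : 0 < a) (hδ : 0 < δ)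
    (hsub : ∀ q : ℝ × ℝ, q.1 ^ 2 + q.2 ^ 2 ≤ a ^ 2 → q ∈ N) {g G : ℝ → ℂ}
    (hg : ContDiff ℝ 1 g) (hGg : ∀ φ, HasDerivAt G (g φ) φ) (hper : G Real.pi = G (-Real.pi)) :
    ‖a * ∫ φ in -Real.pi..Real.pi, g φ * star (V (a * Real.cos φ, a * Real.sin φ))‖ ≤
      δ / 2 * (∫ q in {q : ℝ × ℝ | q.1 ^ 2 + q.2 ^ 2 < a ^ 2}, gradSq V q) +
        a ^ 2 / (4 * δ) * ∫ φ in -Real.pi..Real.pi, (‖g φ‖ ^ 2 + ‖G φ‖ ^ 2) := by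
  have hW : ContDiffOn ℝ 2 (fun q => star (V q)) N := contDiffOn_star_comp (n := 2) hV
  have hderiv : deriv G = g := funext fun φ => (hGg φ).deriv
  have hG : ContDiff ℝ 1 G := contDiff_one_iff_deriv.2
    ⟨fun φ => (hGg φ).differentiableAt, hderiv ▸ hg.continuous⟩
  rw [← setIntegral_polar_trace hN (hW.of_le (by norm_num)) hg hG hGg hper ha.le hsub]
  have h := norm_setIntegral_polar_pairing_le (contDiffOn_partial hN hW (1, 0))
    (contDiffOn_partial hN hW (0, 1)) hg.continuous hG.continuous.neg ha hδ hsub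
  simp only [Pi.neg_apply, norm_neg] at h
  exact h.trans_eq (by congr 3; ext q; exact gradSq_star V q)

theorem norm_integral_star_mul_normalDeriv_le {V : ℝ × ℝ → ℂ} {N : Set (ℝ × ℝ)} (hN : IsOpen N)
    (hV : ContDiffOn ℝ 2 V N) {a : ℝ} (ha : 0 < a)
    (hsub : ∀ q : ℝ × ℝ, q.1 ^ 2 + q.2 ^ 2 ≤ a ^ 2 → q ∈ N)
    (hlap : ∀ q : ℝ × ℝ, q.1 ^ 2 + q.2 ^ 2 ≤ a ^ 2 → lap V q = 0) {h : ℝ → ℂ}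
    (hh : ContDiff ℝ 1 h) (hper : h Real.pi = h (-Real.pi)) :
    ‖a * ∫ φ in -Real.pi..Real.pi, star (h φ) * normalDeriv V a φ‖ ≤
      1 / 4 * (∫ q in {q : ℝ × ℝ | q.1 ^ 2 + q.2 ^ 2 < a ^ 2}, gradSq V q) +
        1 / 2 * ∫ φ in -Real.pi..Real.pi, (‖h φ‖ ^ 2 + ‖deriv h φ‖ ^ 2) := by
  have hs : ContDiff ℝ 1 fun φ => star (h φ) := contDiff_star_comp (n := 1) hh
  have hM : ContDiff ℝ 1 fun p : ℝ × ℝ => (p.1 : ℂ) * star (h p.2) :=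
    (contDiff_ofReal_comp contDiff_fst).mul (hs.comp contDiff_snd)
  have hP := contDiffOn_partial hN hV (1, 0)
  have hQ := contDiffOn_partial hN hV (0, 1)
  have hM1 : ∀ p : ℝ × ℝ, fderiv ℝ (fun p : ℝ × ℝ => (p.1 : ℂ) * star (h p.2)) p (1, 0) =
      star (h p.2) := fun p =>
    fderiv_apply_fst (hM.differentiable one_ne_zero p) (by
      simpa using (Complex.ofRealCLM.hasDerivAt (x := p.1)).mul_const (star (h p.2)))
  have hM2 : ∀ p : ℝ × ℝ, fderiv ℝ (fun p : ℝ × ℝ => (p.1 : ℂ) * star (h p.2)) p (0, 1) =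
      p.1 * star (deriv h p.2) := fun p =>
    fderiv_apply_snd (hM.differentiable one_ne_zero p)
      (((hh.differentiable one_ne_zero p.2).hasDerivAt.star).const_mul (p.1 : ℂ))
  have hkey := setIntegral_polar_divergence_mul hN hP hQ hM (fun r => by simp only [hper]) le_rfl
    ha.le fun q _ hq => hsub q hq
  rw [setIntegral_congr_fun (g := fun p : ℝ × ℝ => ((p.1 : ℂ) * (star (h p.2) *
      radialPart (fun q => fderiv ℝ V q (1, 0)) (fun q => fderiv ℝ V q (0, 1)) p +
      star (deriv h p.2) *
        angularPart (fun q => fderiv ℝ V q (1, 0)) (fun q => fderiv ℝ V q (0, 1)) p) : ℂ))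
    (measurableSet_Icc.prod measurableSet_Icc) ?_] at hkey
  swap
  · intro p hp
    have hp1 : 0 ≤ p.1 ∧ p.1 ≤ a := hp.1
    have hl := hlap (p.1 * Real.cos p.2, p.1 * Real.sin p.2) (by
      have : (p.1 * Real.cos p.2) ^ 2 + (p.1 * Real.sin p.2) ^ 2 = p.1 ^ 2 := by
        linear_combination p.1 ^ 2 * Real.cos_sq_add_sin_sq p.2
      simp only [this]
      exact pow_le_pow_left₀ hp1.1 hp1.2 2)
    unfold lap at hl
    simp only [hM1, hM2, hl]
    ring
  have hb := norm_setIntegral_polar_pairing_le hP hQ hs.continuous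
    (hh.continuous_deriv_one.star) ha (half_pos ha) hsub
  rw [hkey] at hb
  have hR : (∫ φ in -Real.pi..Real.pi, ((a : ℂ) * star (h φ)) *
      (a * radialPart (fun q => fderiv ℝ V q (1, 0)) (fun q => fderiv ℝ V q (0, 1)) (a, φ))) =
      a * (a * ∫ φ in -Real.pi..Real.pi, star (h φ) * normalDeriv V a φ) := by
    rw [← intervalIntegral.integral_const_mul, ← intervalIntegral.integral_const_mul]
    congr 1; ext φ; unfold normalDeriv; ring
  simp only [hR, Complex.ofReal_zero, zero_mul, mul_zero, intervalIntegral.integral_zero, sub_zero,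
    norm_star] at hb
  rw [norm_mul, Complex.norm_real, Real.norm_of_nonneg ha.le] at hb
  refine le_of_mul_le_mul_left (hb.trans_eq ?_) ha
  unfold gradSq
  field_simp
  ring

/-- The energy estimate behind `gradient_estimate_jump_data`, for one disk in one cell. -/
theorem energy_le_of_jump {τ₁ τ₂ a ε : ℝ} (ha : 0 < a) (h₁ : a < τ₁ / 2) (h₂ : a < τ₂ / 2)
    (hε : 0 < ε) {Vi Ve : ℝ × ℝ → ℂ} {Ni Ne : Set (ℝ × ℝ)} (hNi : IsOpen Ni) (hNe : IsOpen Ne)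
    (hVi : ContDiffOn ℝ 2 Vi Ni) (hVe : ContDiffOn ℝ 2 Ve Ne)
    (hsubi : ∀ q : ℝ × ℝ, q.1 ^ 2 + q.2 ^ 2 ≤ a ^ 2 → q ∈ Ni)
    (hlapi : ∀ q : ℝ × ℝ, q.1 ^ 2 + q.2 ^ 2 ≤ a ^ 2 → lap Vi q = 0)
    (hsube : ∀ q ∈ cell τ₁ τ₂, a ^ 2 ≤ q.1 ^ 2 + q.2 ^ 2 → q ∈ Ne)
    (hlape : ∀ q ∈ cell τ₁ τ₂, a ^ 2 ≤ q.1 ^ 2 + q.2 ^ 2 → lap Ve q = 0)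
    (hx : ∀ y ∈ Icc (-τ₂ / 2) (τ₂ / 2), Ve (τ₁ / 2, y) = Ve (-τ₁ / 2, y) ∧
      fderiv ℝ Ve (τ₁ / 2, y) = fderiv ℝ Ve (-τ₁ / 2, y))
    (hy : ∀ x ∈ Icc (-τ₁ / 2) (τ₁ / 2), Ve (x, τ₂ / 2) = Ve (x, -τ₂ / 2) ∧
      fderiv ℝ Ve (x, τ₂ / 2) = fderiv ℝ Ve (x, -τ₂ / 2))
    {h g : ℝ → ℂ} (hh : ContDiff ℝ 2 h) (hg : ContDiff ℝ 1 g)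
    (hper : ∀ φ : ℝ, h (φ + 2 * Real.pi) = h φ)
    (hjump : ∀ φ : ℝ, Ve (a * Real.cos φ, a * Real.sin φ) -
      Vi (a * Real.cos φ, a * Real.sin φ) = h φ)
    (hflux : ∀ φ : ℝ, normalDeriv Ve a φ - (1 / ε : ℂ) * normalDeriv Vi a φ = g φ) :
    1 / (2 * ε) * (∫ q in {q : ℝ × ℝ | q.1 ^ 2 + q.2 ^ 2 < a ^ 2}, gradSq Vi q) +
      (∫ q in cell τ₁ τ₂ ∩ {q | a ^ 2 ≤ q.1 ^ 2 + q.2 ^ 2}, gradSq Ve q) ≤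
      (ε / 2 * (1 + 4 * Real.pi ^ 2) + 1 / 2) * a ^ 2 *
        (∫ φ in -Real.pi..Real.pi, ‖g φ‖ ^ 2) +
      (1 / 2 + 1 / ε) * ((∫ φ in -Real.pi..Real.pi, ‖h φ‖ ^ 2) +
        ∫ φ in -Real.pi..Real.pi, ‖deriv (deriv h) φ‖ ^ 2) := by
  have hpi : -Real.pi ≤ Real.pi := neg_le_self Real.pi_pos.le
  have hend : h Real.pi = h (-Real.pi) := by rw [← hper (-Real.pi)]; congr 1; ring
  have hcell : ∀ q : ℝ × ℝ, q.1 ^ 2 + q.2 ^ 2 = a ^ 2 → q ∈ Ne := fun q hq =>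
    hsube q (mem_cell_of_normSq_le ha.le h₁.le h₂.le hq.le) hq.ge
  have hci : Continuous (normalDeriv Vi a) :=
    continuous_normalDeriv hNi hVi fun q hq => hsubi q hq.le
  have hce : Continuous (normalDeriv Ve a) := continuous_normalDeriv hNe hVe hcell
  have hcVi : Continuous fun φ : ℝ => Vi (a * Real.cos φ, a * Real.sin φ) :=
    continuous_comp_circle hVi.continuousOn fun q hq => hsubi q hq.le
  have hcg : Continuous g := hg.continuous
  have hch : Continuous h := hh.continuous
  have hch1 : Continuous (deriv h) := hh.continuous_deriv (by norm_num)
  have hmean : ∫ φ in -Real.pi..Real.pi, g φ = 0 := by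
    simp only [← hflux]
    rw [intervalIntegral.integral_sub (hce.intervalIntegrable _ _)
      (Continuous.intervalIntegrable (by fun_prop) _ _), intervalIntegral.integral_const_mul,
      integral_normalDeriv_of_disk hNi hVi ha hsubi hlapi,
      integral_normalDeriv_of_exterior hNe hVe ha h₁ h₂ hsube hlape (fun y h => (hx y h).2)
        fun x h => (hy x h).2]
    simp
  obtain ⟨G, hGg, hGper, hGle⟩ := exists_periodic_antiderivative hcg hmean
  have hcG : Continuous G := continuous_iff_continuousAt.2 fun φ => (hGg φ).continuousAt
  have hbg := norm_integral_mul_star_circle_le hNi hVi ha (δ := 1 / (2 * ε)) (by positivity) hsubi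
    hg hGg hGper
  have hbh := norm_integral_star_mul_normalDeriv_le hNi hVi ha hsubi hlapi
    (hh.of_le (by norm_num)) hend
  have hh' := integral_normSq_deriv_le hh hper
  have hei := setIntegral_disk_gradSq hNi hVi ha hsubi hlapi
  have hee := setIntegral_exterior_gradSq hNe hVe ha h₁ h₂ hsube hlape hx hy
  have hbgh : ‖a * ∫ φ in -Real.pi..Real.pi, star (h φ) * g φ‖ ≤
      1 / 2 * (a ^ 2 * (∫ φ in -Real.pi..Real.pi, ‖g φ‖ ^ 2) +
        ∫ φ in -Real.pi..Real.pi, ‖h φ‖ ^ 2) := by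
    have hi1 : IntervalIntegrable (fun φ => ‖g φ‖ ^ 2) volume (-Real.pi) Real.pi :=
      Continuous.intervalIntegrable (by fun_prop) _ _
    have hi2 : IntervalIntegrable (fun φ => ‖h φ‖ ^ 2) volume (-Real.pi) Real.pi :=
      Continuous.intervalIntegrable (by fun_prop) _ _
    rw [← intervalIntegral.integral_const_mul, ← intervalIntegral.integral_const_mul,
      ← intervalIntegral.integral_add (hi1.const_mul _) hi2, ← intervalIntegral.integral_const_mul]
    refine (intervalIntegral.norm_integral_le_integral_norm hpi).trans
      (intervalIntegral.integral_mono_on hpi (Continuous.intervalIntegrable (by fun_prop) _ _)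
        (Continuous.intervalIntegrable (by fun_prop) _ _) fun φ _ => ?_)
    rw [norm_mul, norm_mul, norm_star, Complex.norm_real, Real.norm_of_nonneg ha.le]
    nlinarith [sq_nonneg (a * ‖g φ‖ - ‖h φ‖)]
  have hc1 := hcg.mul hcVi.star
  have hc2 := hcVi.star.mul hci
  have hc3 := hch.star.mul hcg
  have hc4 := hch.star.mul hci
  have hsplit : (∫ φ in -Real.pi..Real.pi,
      star (Ve (a * Real.cos φ, a * Real.sin φ)) * normalDeriv Ve a φ) =
      (∫ φ in -Real.pi..Real.pi, g φ * star (Vi (a * Real.cos φ, a * Real.sin φ))) +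
      (1 / ε : ℂ) * (∫ φ in -Real.pi..Real.pi,
        star (Vi (a * Real.cos φ, a * Real.sin φ)) * normalDeriv Vi a φ) +
      (∫ φ in -Real.pi..Real.pi, star (h φ) * g φ) +
      (1 / ε : ℂ) * ∫ φ in -Real.pi..Real.pi, star (h φ) * normalDeriv Vi a φ := by
    rw [← intervalIntegral.integral_const_mul, ← intervalIntegral.integral_const_mul,
      ← intervalIntegral.integral_add, ← intervalIntegral.integral_add,
      ← intervalIntegral.integral_add]
    · congr 1
      ext φ
      rw [← hjump φ, ← hflux φ, star_sub]
      ring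
    · exact (((hc1.add (continuous_const.mul hc2)).add hc3).intervalIntegrable _ _)
    · exact (continuous_const.mul hc4).intervalIntegrable _ _
    · exact (hc1.add (continuous_const.mul hc2)).intervalIntegrable _ _
    · exact hc3.intervalIntegrable _ _
    · exact hc1.intervalIntegrable _ _
    · exact (continuous_const.mul hc2).intervalIntegrable _ _
  have hid : ((1 / ε * (∫ q in {q : ℝ × ℝ | q.1 ^ 2 + q.2 ^ 2 < a ^ 2}, gradSq Vi q) +
      ∫ q in cell τ₁ τ₂ ∩ {q | a ^ 2 ≤ q.1 ^ 2 + q.2 ^ 2}, gradSq Ve q : ℝ) : ℂ) =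
      -(a * ∫ φ in -Real.pi..Real.pi, g φ * star (Vi (a * Real.cos φ, a * Real.sin φ))) -
      a * (∫ φ in -Real.pi..Real.pi, star (h φ) * g φ) -
      (1 / ε : ℂ) * (a * ∫ φ in -Real.pi..Real.pi, star (h φ) * normalDeriv Vi a φ) := by
    rw [Complex.ofReal_add, Complex.ofReal_mul, hei, hee, hsplit]
    push_cast
    ring
  have hnorm := (le_abs_self _).trans_eq ((Complex.norm_real _).symm.trans (congrArg norm hid))
  have hn1 : ‖(1 / ε : ℂ) * (a * ∫ φ in -Real.pi..Real.pi, star (h φ) * normalDeriv Vi a φ)‖ =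
      1 / ε * ‖a * ∫ φ in -Real.pi..Real.pi, star (h φ) * normalDeriv Vi a φ‖ := by
    rw [norm_mul, norm_div, norm_one, Complex.norm_real, Real.norm_of_nonneg hε.le]
  have htri := hnorm.trans ((norm_sub_le _ _).trans (add_le_add (norm_sub_le _ _) le_rfl))
  rw [norm_neg, hn1] at htri
  have hi1 : IntervalIntegrable (fun φ => ‖g φ‖ ^ 2) volume (-Real.pi) Real.pi :=
    Continuous.intervalIntegrable (by fun_prop) _ _
  have hi2 : IntervalIntegrable (fun φ => ‖G φ‖ ^ 2) volume (-Real.pi) Real.pi :=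
    Continuous.intervalIntegrable (by fun_prop) _ _
  have hi3 : IntervalIntegrable (fun φ => ‖h φ‖ ^ 2) volume (-Real.pi) Real.pi :=
    Continuous.intervalIntegrable (by fun_prop) _ _
  have hi4 : IntervalIntegrable (fun φ => ‖deriv h φ‖ ^ 2) volume (-Real.pi) Real.pi :=
    Continuous.intervalIntegrable (by fun_prop) _ _
  rw [intervalIntegral.integral_add hi1 hi2] at hbg
  rw [intervalIntegral.integral_add hi3 hi4] at hbh
  have hH0 : 0 ≤ ∫ φ in -Real.pi..Real.pi, ‖h φ‖ ^ 2 :=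
    intervalIntegral.integral_nonneg hpi fun _ _ => sq_nonneg _
  have hH2 : 0 ≤ ∫ φ in -Real.pi..Real.pi, ‖deriv (deriv h) φ‖ ^ 2 :=
    intervalIntegral.integral_nonneg hpi fun _ _ => sq_nonneg _
  generalize (∫ q in {q : ℝ × ℝ | q.1 ^ 2 + q.2 ^ 2 < a ^ 2}, gradSq Vi q) = Ei at *
  generalize (∫ q in cell τ₁ τ₂ ∩ {q | a ^ 2 ≤ q.1 ^ 2 + q.2 ^ 2}, gradSq Ve q) = Ee at *
  generalize (∫ φ in -Real.pi..Real.pi, ‖g φ‖ ^ 2) = g0 at *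
  generalize (∫ φ in -Real.pi..Real.pi, ‖G φ‖ ^ 2) = G0 at *
  generalize (∫ φ in -Real.pi..Real.pi, ‖h φ‖ ^ 2) = h0 at *
  generalize (∫ φ in -Real.pi..Real.pi, ‖deriv h φ‖ ^ 2) = hd at *
  generalize (∫ φ in -Real.pi..Real.pi, ‖deriv (deriv h) φ‖ ^ 2) = h2 at *
  have e1 := htri.trans (add_le_add (add_le_add hbg hbgh)
    (mul_le_mul_of_nonneg_left hbh (by positivity : (0 : ℝ) ≤ 1 / ε)))
  have e2 : 1 / (2 * ε) / 2 * Ei = 1 / ε * Ei / 4 := by field_simp; ring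
  have e3 : 1 / (2 * ε) * Ei = 1 / ε * Ei / 2 := by field_simp
  have e4 : a ^ 2 / (4 * (1 / (2 * ε))) = ε / 2 * a ^ 2 := by field_simp; ring
  have e5 := mul_le_mul_of_nonneg_left hGle (by positivity : 0 ≤ ε / 2 * a ^ 2)
  have e6 := mul_le_mul_of_nonneg_left hh' (by positivity : 0 ≤ 1 / ε)
  have e7 := mul_nonneg (by positivity : 0 ≤ 1 / ε) hH0
  have e8 := mul_nonneg (by positivity : 0 ≤ 1 / ε) hH2
  rw [e2, e4] at e1
  rw [e3]
  linarith

theorem sq_lt_sq_sub_mul {x τ a : ℝ} {m : ℤ} (hm : m ≠ 0) (ha : 0 < a) (hx : |x| < τ - a) :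
    a ^ 2 < (x - m * τ) ^ 2 := by
  have hm1 : (1 : ℝ) ≤ |(m : ℝ)| := by exact_mod_cast Int.one_le_abs hm
  have hτ : 0 < τ := by linarith [abs_nonneg x]
  have h1 : |(m : ℝ) * τ| = |(m : ℝ)| * τ := by rw [abs_mul, abs_of_pos hτ]
  have h2 := abs_sub_abs_le_abs_sub ((m : ℝ) * τ) x
  rw [abs_sub_comm, h1] at h2
  refine sq_lt_sq.2 ?_
  rw [abs_of_pos ha]
  nlinarith

theorem notMem_disks {τ₁ τ₂ a : ℝ} (ha : 0 < a) {q : ℝ × ℝ} (hq : a ^ 2 ≤ q.1 ^ 2 + q.2 ^ 2)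
    (h₁ : |q.1| < τ₁ - a) (h₂ : |q.2| < τ₂ - a) : q ∉ disks τ₁ τ₂ a := by
  rintro ⟨p, ⟨m, n, rfl⟩, hlt⟩
  simp only at hlt
  by_cases hm : m = 0
  · by_cases hn : n = 0
    · subst hm hn
      simp only [Int.cast_zero, zero_mul, sub_zero] at hlt
      linarith
    · nlinarith [sq_lt_sq_sub_mul hn ha h₂, sq_nonneg (q.1 - m * τ₁)]
  · nlinarith [sq_lt_sq_sub_mul hm ha h₁, sq_nonneg (q.2 - n * τ₂)]

theorem zero_mem_centers (τ₁ τ₂ : ℝ) : ((0, 0) : ℝ × ℝ) ∈ centers τ₁ τ₂ := ⟨0, 0, by simp⟩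

theorem disk_subset_disks (τ₁ τ₂ a : ℝ) :
    {q : ℝ × ℝ | q.1 ^ 2 + q.2 ^ 2 < a ^ 2} ⊆ disks τ₁ τ₂ a := fun q hq =>
  ⟨(0, 0), zero_mem_centers τ₁ τ₂, by simpa using hq⟩

theorem mem_closure_disk {a : ℝ} (ha : 0 < a) {q : ℝ × ℝ} (hq : q.1 ^ 2 + q.2 ^ 2 ≤ a ^ 2) :
    q ∈ closure {q : ℝ × ℝ | q.1 ^ 2 + q.2 ^ 2 < a ^ 2} := by
  have ht : Filter.Tendsto (fun t : ℝ => t • q) (nhdsWithin 1 (Iio 1)) (nhds q) := by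
    have : Filter.Tendsto (fun t : ℝ => t • q) (nhds 1) (nhds ((1 : ℝ) • q)) :=
      (continuous_id.smul continuous_const).tendsto 1
    rw [one_smul] at this
    exact this.mono_left nhdsWithin_le_nhds
  refine mem_closure_of_tendsto ht ?_
  filter_upwards [Ioo_mem_nhdsLT (zero_lt_one' ℝ)] with t ht
  simp only [Prod.smul_fst, Prod.smul_snd, smul_eq_mul]
  have h1 : t ^ 2 < 1 := by nlinarith [ht.1, ht.2]
  nlinarith [sq_nonneg q.1, sq_nonneg q.2, pow_pos ha 2]

/-- A neighbourhood of the part of the cell outside the closed central disk, away from all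
disks. -/
def exteriorRegion (τ₁ τ₂ a : ℝ) : Set (ℝ × ℝ) :=
  {q | a ^ 2 < q.1 ^ 2 + q.2 ^ 2 ∧ |q.1| < τ₁ - a ∧ |q.2| < τ₂ - a}

theorem isOpen_abs_lt_and_abs_lt (s t : ℝ) : IsOpen {q : ℝ × ℝ | |q.1| < s ∧ |q.2| < t} := by
  simp only [ofPred_and]
  exact (isOpen_lt (by fun_prop) continuous_const).inter
    (isOpen_lt (by fun_prop) continuous_const)

theorem isOpen_exteriorRegion (τ₁ τ₂ a : ℝ) : IsOpen (exteriorRegion τ₁ τ₂ a) := by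
  unfold exteriorRegion
  rw [ofPred_and]
  exact (isOpen_lt continuous_const (by fun_prop)).inter (isOpen_abs_lt_and_abs_lt _ _)

theorem exteriorRegion_subset_compl_closure {τ₁ τ₂ a : ℝ} (ha : 0 < a) :
    exteriorRegion τ₁ τ₂ a ⊆ (closure (disks τ₁ τ₂ a))ᶜ := by
  have hdisj : Disjoint (disks τ₁ τ₂ a) (exteriorRegion τ₁ τ₂ a) :=
    disjoint_left.2 fun q hq hq' => notMem_disks ha hq'.1.le hq'.2.1 hq'.2.2 hq
  exact fun q hq hq' =>
    disjoint_left.1 (hdisj.closure_left (isOpen_exteriorRegion τ₁ τ₂ a)) hq' hq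

theorem abs_lt_of_mem_cell {τ₁ τ₂ a : ℝ} (h₁ : a < τ₁ / 2) (h₂ : a < τ₂ / 2) {q : ℝ × ℝ}
    (hq : q ∈ cell τ₁ τ₂) : |q.1| < τ₁ - a ∧ |q.2| < τ₂ - a := by
  obtain ⟨⟨hx, hx'⟩, hy, hy'⟩ := hq
  constructor <;> rw [abs_lt] <;> constructor <;> linarith

theorem mem_closure_exteriorRegion {τ₁ τ₂ a : ℝ} (ha : 0 < a) (h₁ : a < τ₁ / 2)
    (h₂ : a < τ₂ / 2) {q : ℝ × ℝ} (hq : q ∈ cell τ₁ τ₂) (hqa : a ^ 2 ≤ q.1 ^ 2 + q.2 ^ 2) :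
    q ∈ closure (exteriorRegion τ₁ τ₂ a) := by
  have hq' := abs_lt_of_mem_cell h₁ h₂ hq
  have ht : Filter.Tendsto (fun t : ℝ => t • q) (nhdsWithin 1 (Ioi 1)) (nhds q) := by
    have : Filter.Tendsto (fun t : ℝ => t • q) (nhds 1) (nhds ((1 : ℝ) • q)) :=
      (continuous_id.smul continuous_const).tendsto 1
    rw [one_smul] at this
    exact this.mono_left nhdsWithin_le_nhds
  refine mem_closure_of_tendsto ht ?_
  filter_upwards [ht ((isOpen_abs_lt_and_abs_lt _ _).mem_nhds hq'), self_mem_nhdsWithin]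
    with t ht1 ht2
  refine ⟨?_, ht1⟩
  simp only [Prod.smul_fst, Prod.smul_snd, smul_eq_mul]
  have h1 : 1 < t ^ 2 := by nlinarith [show 1 < t from ht2]
  nlinarith [sq_nonneg q.1, sq_nonneg q.2, pow_pos ha 2]

theorem eq_zero_of_mem_closure {f : ℝ × ℝ → ℂ} {A : Set (ℝ × ℝ)} {q : ℝ × ℝ}
    (hf : ContinuousAt f q) (hA : ∀ x ∈ A, f x = 0) (hq : q ∈ closure A) : f q = 0 :=
  isClosed_singleton.mem_of_frequently_of_tendsto
    ((mem_closure_iff_frequently.1 hq).mono hA) hf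

theorem continuousAt_lap {V : ℝ × ℝ → ℂ} {N : Set (ℝ × ℝ)} (hN : IsOpen N)
    (hV : ContDiffOn ℝ 2 V N) {q : ℝ × ℝ} (hq : q ∈ N) : ContinuousAt (lap V) q := by
  have hd : ∀ e, ContinuousAt (fun q => fderiv ℝ (fun p => fderiv ℝ V p e) q e) q := fun e =>
    (((contDiffOn_partial hN hV e).continuousOn_fderiv_of_isOpen hN le_rfl).clm_apply
      continuousOn_const).continuousAt (hN.mem_nhds hq)
  exact (hd (1, 0)).add (hd (0, 1))

theorem fderiv_add_period {v : ℝ × ℝ → ℂ} {c : ℝ × ℝ} (hv : ∀ r, v (r + c) = v r) (r : ℝ × ℝ) :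
    fderiv ℝ v (r + c) = fderiv ℝ v r := by
  rw [← fderiv_comp_add_right]
  congr 1
  exact funext hv

theorem volume_circle (a : ℝ) : volume {q : ℝ × ℝ | q.1 ^ 2 + q.2 ^ 2 = a ^ 2} = 0 := by
  have hm : MeasurableSet {q : ℝ × ℝ | q.1 ^ 2 + q.2 ^ 2 = a ^ 2} :=
    (isClosed_eq (by fun_prop) continuous_const).measurableSet
  rw [Measure.volume_eq_prod, Measure.measure_prod_null hm]
  refine Filter.Eventually.of_forall fun x => ?_
  have hfin : ({Real.sqrt (a ^ 2 - x ^ 2), -Real.sqrt (a ^ 2 - x ^ 2)} : Set ℝ).Finite :=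
    toFinite _
  refine measure_mono_null (fun y hy => ?_) (hfin.measure_zero volume)
  have hy' : a ^ 2 - x ^ 2 = y ^ 2 := by
    have : x ^ 2 + y ^ 2 = a ^ 2 := hy
    linarith
  rw [hy', Real.sqrt_sq_eq_abs]
  rcases abs_choice y with h | h <;> simp [h]

theorem continuousOn_gradSq {V : ℝ × ℝ → ℂ} {N : Set (ℝ × ℝ)} (hN : IsOpen N)
    (hV : ContDiffOn ℝ 2 V N) : ContinuousOn (gradSq V) N :=
  ((contDiffOn_partial hN hV (1, 0)).continuousOn.norm.pow 2).add
    ((contDiffOn_partial hN hV (0, 1)).continuousOn.norm.pow 2)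

theorem isCompact_closedDisk (a : ℝ) : IsCompact {q : ℝ × ℝ | q.1 ^ 2 + q.2 ^ 2 ≤ a ^ 2} := by
  have hc : IsClosed {q : ℝ × ℝ | q.1 ^ 2 + q.2 ^ 2 ≤ a ^ 2} :=
    isClosed_le (by fun_prop) continuous_const
  refine IsCompact.of_isClosed_subset (s := Icc (-|a|) |a| ×ˢ Icc (-|a|) |a|)
    (isCompact_Icc.prod isCompact_Icc) hc fun q hq => ⟨?_, ?_⟩ <;>
  · have hq' : q.1 ^ 2 + q.2 ^ 2 ≤ a ^ 2 := hq
    refine abs_le.1 (sq_le_sq.1 ?_)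
    nlinarith [sq_nonneg q.1, sq_nonneg q.2]

theorem setIntegral_cell_gradSq {τ₁ τ₂ a : ℝ} (ha : 0 < a) (h₁ : a < τ₁ / 2) (h₂ : a < τ₂ / 2)
    {v Vi Ve : ℝ × ℝ → ℂ} {Ni Ne : Set (ℝ × ℝ)} (hNi : IsOpen Ni) (hNe : IsOpen Ne)
    (hVi : ContDiffOn ℝ 2 Vi Ni) (hVe : ContDiffOn ℝ 2 Ve Ne)
    (hsubi : ∀ q : ℝ × ℝ, q.1 ^ 2 + q.2 ^ 2 ≤ a ^ 2 → q ∈ Ni)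
    (hsube : ∀ q ∈ cell τ₁ τ₂, a ^ 2 ≤ q.1 ^ 2 + q.2 ^ 2 → q ∈ Ne)
    (hvi : ∀ q : ℝ × ℝ, q.1 ^ 2 + q.2 ^ 2 < a ^ 2 → fderiv ℝ v q = fderiv ℝ Vi q)
    (hve : ∀ q ∈ cell τ₁ τ₂, a ^ 2 < q.1 ^ 2 + q.2 ^ 2 → fderiv ℝ v q = fderiv ℝ Ve q) :
    (∫ q in cell τ₁ τ₂, gradSq v q) =
      (∫ q in {q : ℝ × ℝ | q.1 ^ 2 + q.2 ^ 2 < a ^ 2}, gradSq Vi q) +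
      ∫ q in cell τ₁ τ₂ ∩ {q | a ^ 2 ≤ q.1 ^ 2 + q.2 ^ 2}, gradSq Ve q := by
  have hcell : cell τ₁ τ₂ = {q : ℝ × ℝ | q.1 ^ 2 + q.2 ^ 2 < a ^ 2} ∪
      (cell τ₁ τ₂ ∩ {q | a ^ 2 ≤ q.1 ^ 2 + q.2 ^ 2}) := by
    ext q
    constructor
    · exact fun hq => (lt_or_ge (q.1 ^ 2 + q.2 ^ 2) (a ^ 2)).imp id fun h => ⟨hq, h⟩
    · rintro (hq | hq)
      · exact mem_cell_of_normSq_le ha.le h₁.le h₂.le (le_of_lt hq)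
      · exact hq.1
  have hdisj : Disjoint {q : ℝ × ℝ | q.1 ^ 2 + q.2 ^ 2 < a ^ 2}
      (cell τ₁ τ₂ ∩ {q | a ^ 2 ≤ q.1 ^ 2 + q.2 ^ 2}) :=
    by
    refine disjoint_left.2 fun q hq hq' => ?_
    have hq1 : q.1 ^ 2 + q.2 ^ 2 < a ^ 2 := hq
    exact hq1.not_ge hq'.2
  have hmE := measurableSet_cell_inter_exterior τ₁ τ₂ a
  have hci : EqOn (gradSq v) (gradSq Vi) {q : ℝ × ℝ | q.1 ^ 2 + q.2 ^ 2 < a ^ 2} :=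
    fun q hq => by simp only [gradSq, hvi q hq]
  have hce : ∀ᵐ q ∂volume, q ∈ cell τ₁ τ₂ ∩ {q | a ^ 2 ≤ q.1 ^ 2 + q.2 ^ 2} →
      gradSq v q = gradSq Ve q := by
    filter_upwards [measure_eq_zero_iff_ae_notMem.1 (volume_circle a)] with q hq hqE
    have hne : a ^ 2 ≠ q.1 ^ 2 + q.2 ^ 2 := fun h => hq h.symm
    simp only [gradSq, hve q hqE.1 (lt_of_le_of_ne hqE.2 hne)]
  have hIi : IntegrableOn (gradSq Vi) {q : ℝ × ℝ | q.1 ^ 2 + q.2 ^ 2 < a ^ 2} :=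
    (((continuousOn_gradSq hNi hVi).mono hsubi).integrableOn_compact
      (isCompact_closedDisk a)).mono_set
      (ofPred_subset_ofPred.2 fun q hq => hq.le)
  have hIe : IntegrableOn (gradSq Ve) (cell τ₁ τ₂ ∩ {q | a ^ 2 ≤ q.1 ^ 2 + q.2 ^ 2}) :=
    ((continuousOn_gradSq hNe hVe).mono fun q hq => hsube q hq.1 hq.2).integrableOn_compact
      (isCompact_cell_inter_exterior τ₁ τ₂ a)
  conv_lhs => rw [hcell]
  rw [setIntegral_union hdisj hmE (hIi.congr_fun hci.symm (measurableSet_disk a))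
    (hIe.congr_fun_ae ((ae_restrict_iff' hmE).2 (hce.mono fun q h hq => (h hq).symm))),
    setIntegral_congr_fun (measurableSet_disk a) hci, setIntegral_congr_ae hmE hce]

theorem normalDeriv_eq_fderiv (V : ℝ × ℝ → ℂ) (a φ : ℝ) :
    normalDeriv V a φ =
      fderiv ℝ V (a * Real.cos φ, a * Real.sin φ) (Real.cos φ, Real.sin φ) := by
  rw [fderiv_apply_pair]; rfl

theorem integral_normSq_eq_of_periodic {f : ℝ → ℂ} (hf : ∀ φ : ℝ, f (φ + 2 * Real.pi) = f φ) :
    (∫ φ in -Real.pi..Real.pi, ‖f φ‖ ^ 2) = ∫ φ in (0 : ℝ)..(2 * Real.pi), ‖f φ‖ ^ 2 := by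
  have hp : Function.Periodic (fun φ => ‖f φ‖ ^ 2) (2 * Real.pi) := fun φ => by simp only [hf φ]
  have h := hp.intervalIntegral_add_eq (-Real.pi) 0
  rwa [zero_add, show -Real.pi + 2 * Real.pi = Real.pi by ring] at h

theorem deriv_periodic {f : ℝ → ℂ} {c : ℝ} (hf : ∀ φ : ℝ, f (φ + c) = f φ) (φ : ℝ) :
    deriv f (φ + c) = deriv f φ := by
  rw [← deriv_comp_add_const]
  congr 1
  exact funext hf

/-- **Gradient estimate for the harmonic problem with jump data on the circles**:
`‖∇v‖_{L²(S)} ≤ c₁‖g‖ + (c₂/a)‖h‖` with constants independent of `a`, where the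
norms of the jump data `g, h` involve the functions and their second
derivatives. -/
theorem gradient_estimate_jump_data (τ₁ τ₂ ε : ℝ)
    (hτ₁ : 0 < τ₁) (hτ₂ : 0 < τ₂) (hε : 0 < ε) :
    ∃ c₁ > (0:ℝ), ∃ c₂ > (0:ℝ), ∀ a : ℝ, 0 < a → a < min τ₁ τ₂ / 2 →
      ∀ h g : ℝ → ℂ, ContDiff ℝ 2 h → ContDiff ℝ 2 g →
        (∀ φ : ℝ, h (φ + 2 * Real.pi) = h φ) →
        (∀ φ : ℝ, g (φ + 2 * Real.pi) = g φ) →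
        ∀ v Vin Vex : ℝ × ℝ → ℂ,
          (∃ N : Set (ℝ × ℝ), IsOpen N ∧ closure (disks τ₁ τ₂ a) ⊆ N ∧
            ContDiffOn ℝ 2 Vin N) →
          (∃ N : Set (ℝ × ℝ), IsOpen N ∧ (disks τ₁ τ₂ a)ᶜ ⊆ N ∧
            ContDiffOn ℝ 2 Vex N) →
          (∀ q ∈ disks τ₁ τ₂ a, v q = Vin q) →
          (∀ q ∈ (closure (disks τ₁ τ₂ a))ᶜ, v q = Vex q) →
          (∀ q ∈ disks τ₁ τ₂ a, lap Vin q = 0) →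
          (∀ q ∈ (closure (disks τ₁ τ₂ a))ᶜ, lap Vex q = 0) →
          (∀ r : ℝ × ℝ, v (r.1 + τ₁, r.2) = v r) →
          (∀ r : ℝ × ℝ, v (r.1, r.2 + τ₂) = v r) →
          v (0, 0) = 0 →
          (∀ p ∈ centers τ₁ τ₂, ∀ φ : ℝ,
            Vex (p.1 + a * Real.cos φ, p.2 + a * Real.sin φ) -
              Vin (p.1 + a * Real.cos φ, p.2 + a * Real.sin φ) = h φ) →
          (∀ p ∈ centers τ₁ τ₂, ∀ φ : ℝ,
            fderiv ℝ Vex (p.1 + a * Real.cos φ, p.2 + a * Real.sin φ)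
                (Real.cos φ, Real.sin φ) -
              (1 / ε : ℂ) *
                fderiv ℝ Vin (p.1 + a * Real.cos φ, p.2 + a * Real.sin φ)
                  (Real.cos φ, Real.sin φ) = g φ) →
          Real.sqrt (∫ r in cell τ₁ τ₂,
              (‖fderiv ℝ v r (1, 0)‖ ^ 2 + ‖fderiv ℝ v r (0, 1)‖ ^ 2)) ≤
            c₁ * Real.sqrt (∫ φ in (0:ℝ)..(2 * Real.pi),
                (‖g φ‖ ^ 2 + ‖deriv (deriv g) φ‖ ^ 2)) +
              (c₂ / a) * Real.sqrt (∫ φ in (0:ℝ)..(2 * Real.pi),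
                (‖h φ‖ ^ 2 + ‖deriv (deriv h) φ‖ ^ 2)) := by
  set κ : ℝ := min (1 / (2 * ε)) 1 with hκdef
  have hκ : 0 < κ := lt_min (by positivity) one_pos
  set A : ℝ := ε / 2 * (1 + 4 * Real.pi ^ 2) + 1 / 2 with hAdef
  set B : ℝ := 1 / 2 + 1 / ε with hBdef
  have hA : 0 < A := by positivity
  have hB : 0 < B := by positivity
  set C : ℝ := Real.sqrt ((A + B) / κ) with hCdef
  have hC : 0 < C := Real.sqrt_pos.2 (by positivity)
  have hC2 : C ^ 2 = (A + B) / κ := Real.sq_sqrt (by positivity)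
  have hm : 0 < min τ₁ τ₂ / 2 := half_pos (lt_min hτ₁ hτ₂)
  refine ⟨C * (min τ₁ τ₂ / 2), by positivity, C * (min τ₁ τ₂ / 2), by positivity, ?_⟩
  rintro a ha ham h g hh hg hhper hgper v Vi Ve ⟨Ni, hNi, hNi', hVi⟩ ⟨Ne, hNe, hNe', hVe⟩ hvi hve
    hlapi hlape hvx hvy - hjump hflux
  have h₁ : a < τ₁ / 2 := ham.trans_le (by linarith [min_le_left τ₁ τ₂])
  have h₂ : a < τ₂ / 2 := ham.trans_le (by linarith [min_le_right τ₁ τ₂])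
  have hsubi : ∀ q : ℝ × ℝ, q.1 ^ 2 + q.2 ^ 2 ≤ a ^ 2 → q ∈ Ni := fun q hq =>
    hNi' (closure_mono (disk_subset_disks τ₁ τ₂ a) (mem_closure_disk ha hq))
  have hsube : ∀ q ∈ cell τ₁ τ₂, a ^ 2 ≤ q.1 ^ 2 + q.2 ^ 2 → q ∈ Ne := fun q hq hqa =>
    have hq' := abs_lt_of_mem_cell h₁ h₂ hq
    hNe' (notMem_disks ha hqa hq'.1 hq'.2)
  have hlapi' : ∀ q : ℝ × ℝ, q.1 ^ 2 + q.2 ^ 2 ≤ a ^ 2 → lap Vi q = 0 := fun q hq =>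
    eq_zero_of_mem_closure (continuousAt_lap hNi hVi (hsubi q hq))
      (fun x hx => hlapi x (disk_subset_disks τ₁ τ₂ a hx)) (mem_closure_disk ha hq)
  have hlape' : ∀ q ∈ cell τ₁ τ₂, a ^ 2 ≤ q.1 ^ 2 + q.2 ^ 2 → lap Ve q = 0 := fun q hq hqa =>
    eq_zero_of_mem_closure (continuousAt_lap hNe hVe (hsube q hq hqa))
      (fun x hx => hlape x (exteriorRegion_subset_compl_closure ha hx))
      (mem_closure_exteriorRegion ha h₁ h₂ hq hqa)
  have hveq : ∀ q ∈ exteriorRegion τ₁ τ₂ a, Ve q = v q ∧ fderiv ℝ Ve q = fderiv ℝ v q :=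
    fun q hq => ⟨(hve q (exteriorRegion_subset_compl_closure ha hq)).symm,
      Filter.EventuallyEq.fderiv_eq <| by
        filter_upwards [(isOpen_exteriorRegion τ₁ τ₂ a).mem_nhds hq] with x hx
        exact (hve x (exteriorRegion_subset_compl_closure ha hx)).symm⟩
  have hregion : ∀ q ∈ cell τ₁ τ₂, a ^ 2 < q.1 ^ 2 + q.2 ^ 2 → q ∈ exteriorRegion τ₁ τ₂ a :=
    fun q hq hqa => ⟨hqa, abs_lt_of_mem_cell h₁ h₂ hq⟩
  have hvx' : ∀ r : ℝ × ℝ, v (r + (τ₁, 0)) = v r := fun r => by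
    rw [← hvx r]; congr 1; ext <;> simp
  have hvy' : ∀ r : ℝ × ℝ, v (r + (0, τ₂)) = v r := fun r => by
    rw [← hvy r]; congr 1; ext <;> simp
  have hx : ∀ y ∈ Icc (-τ₂ / 2) (τ₂ / 2), Ve (τ₁ / 2, y) = Ve (-τ₁ / 2, y) ∧
      fderiv ℝ Ve (τ₁ / 2, y) = fderiv ℝ Ve (-τ₁ / 2, y) := fun y hy => by
    have e : ((τ₁ / 2, y) : ℝ × ℝ) = (-τ₁ / 2, y) + (τ₁, 0) := by
      ext <;> simp; ring
    have hr := hveq (τ₁ / 2, y) (hregion _ ⟨⟨by simp only; linarith, le_rfl⟩, hy⟩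
      (by simp only; nlinarith [sq_nonneg y]))
    have hl := hveq (-τ₁ / 2, y) (hregion _ ⟨⟨le_rfl, by simp only; linarith⟩, hy⟩
      (by simp only; nlinarith [sq_nonneg y]))
    rw [hr.1, hr.2, hl.1, hl.2, e, hvx', fderiv_add_period hvx']
    exact ⟨rfl, rfl⟩
  have hy : ∀ x ∈ Icc (-τ₁ / 2) (τ₁ / 2), Ve (x, τ₂ / 2) = Ve (x, -τ₂ / 2) ∧
      fderiv ℝ Ve (x, τ₂ / 2) = fderiv ℝ Ve (x, -τ₂ / 2) := fun x hx => by
    have e : ((x, τ₂ / 2) : ℝ × ℝ) = (x, -τ₂ / 2) + (0, τ₂) := by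
      ext <;> simp; ring
    have hr := hveq (x, τ₂ / 2) (hregion _ ⟨hx, ⟨by simp only; linarith, le_rfl⟩⟩
      (by simp only; nlinarith [sq_nonneg x]))
    have hl := hveq (x, -τ₂ / 2) (hregion _ ⟨hx, ⟨le_rfl, by simp only; linarith⟩⟩
      (by simp only; nlinarith [sq_nonneg x]))
    rw [hr.1, hr.2, hl.1, hl.2, e, hvy', fderiv_add_period hvy']
    exact ⟨rfl, rfl⟩
  have henergy := energy_le_of_jump ha h₁ h₂ hε hNi hNe hVi hVe hsubi hlapi' hsube hlape' hx hy
    hh (hg.of_le (by norm_num)) hhper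
    (fun φ => by simpa using hjump (0, 0) (zero_mem_centers τ₁ τ₂) φ)
    (fun φ => by simpa [normalDeriv_eq_fderiv] using hflux (0, 0) (zero_mem_centers τ₁ τ₂) φ)
  have hcell := setIntegral_cell_gradSq ha h₁ h₂ hNi hNe hVi hVe hsubi hsube
    (fun q hq => Filter.EventuallyEq.fderiv_eq <| by
      have ho : IsOpen {q : ℝ × ℝ | q.1 ^ 2 + q.2 ^ 2 < a ^ 2} :=
        isOpen_lt (by fun_prop) continuous_const
      filter_upwards [ho.mem_nhds hq] with x hx
      exact hvi x (disk_subset_disks τ₁ τ₂ a hx))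
    (fun q hq hqa => (hveq q (hregion q hq hqa)).2.symm)
  have hcg : Continuous g := hg.continuous
  have hch : Continuous h := hh.continuous
  have hcg2 : Continuous (deriv (deriv g)) := hg.deriv'.continuous_deriv_one
  have hch2 : Continuous (deriv (deriv h)) := hh.deriv'.continuous_deriv_one
  rw [integral_normSq_eq_of_periodic hgper, integral_normSq_eq_of_periodic hhper,
    integral_normSq_eq_of_periodic (deriv_periodic (deriv_periodic hhper))] at henergy
  have hiH : (∫ φ in (0 : ℝ)..(2 * Real.pi), (‖h φ‖ ^ 2 + ‖deriv (deriv h) φ‖ ^ 2)) =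
      (∫ φ in (0 : ℝ)..(2 * Real.pi), ‖h φ‖ ^ 2) +
        ∫ φ in (0 : ℝ)..(2 * Real.pi), ‖deriv (deriv h) φ‖ ^ 2 :=
    intervalIntegral.integral_add (Continuous.intervalIntegrable (by fun_prop) _ _)
      (Continuous.intervalIntegrable (by fun_prop) _ _)
  have hiG : (∫ φ in (0 : ℝ)..(2 * Real.pi), ‖g φ‖ ^ 2) ≤
      ∫ φ in (0 : ℝ)..(2 * Real.pi), (‖g φ‖ ^ 2 + ‖deriv (deriv g) φ‖ ^ 2) :=
    intervalIntegral.integral_mono_on (by positivity)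
      (Continuous.intervalIntegrable (by fun_prop) _ _)
      (Continuous.intervalIntegrable (by fun_prop) _ _)
      fun φ _ => le_add_of_nonneg_right (sq_nonneg _)
  have hH0 : 0 ≤ ∫ φ in (0 : ℝ)..(2 * Real.pi), (‖h φ‖ ^ 2 + ‖deriv (deriv h) φ‖ ^ 2) :=
    intervalIntegral.integral_nonneg (by positivity) fun _ _ => by positivity
  have hG0 : 0 ≤ ∫ φ in (0 : ℝ)..(2 * Real.pi), (‖g φ‖ ^ 2 + ‖deriv (deriv g) φ‖ ^ 2) :=
    intervalIntegral.integral_nonneg (by positivity) fun _ _ => by positivity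
  rw [← hiH] at henergy
  have hEi : 0 ≤ ∫ q in {q : ℝ × ℝ | q.1 ^ 2 + q.2 ^ 2 < a ^ 2}, gradSq Vi q :=
    integral_nonneg fun q => add_nonneg (sq_nonneg _) (sq_nonneg _)
  have hEe : 0 ≤ ∫ q in cell τ₁ τ₂ ∩ {q | a ^ 2 ≤ q.1 ^ 2 + q.2 ^ 2}, gradSq Ve q :=
    integral_nonneg fun q => add_nonneg (sq_nonneg _) (sq_nonneg _)
  change Real.sqrt (∫ q in cell τ₁ τ₂, gradSq v q) ≤ _
  rw [hcell]
  generalize (∫ q in {q : ℝ × ℝ | q.1 ^ 2 + q.2 ^ 2 < a ^ 2}, gradSq Vi q) = Ei at *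
  generalize (∫ q in cell τ₁ τ₂ ∩ {q | a ^ 2 ≤ q.1 ^ 2 + q.2 ^ 2}, gradSq Ve q) = Ee at *
  generalize (∫ φ in (0 : ℝ)..(2 * Real.pi), (‖h φ‖ ^ 2 + ‖deriv (deriv h) φ‖ ^ 2)) = H at *
  generalize (∫ φ in (0 : ℝ)..(2 * Real.pi), (‖g φ‖ ^ 2 + ‖deriv (deriv g) φ‖ ^ 2)) = G at *
  generalize (∫ φ in (0 : ℝ)..(2 * Real.pi), ‖g φ‖ ^ 2) = G₀ at *
  rw [← hAdef, ← hBdef] at henergy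
  have hκE : κ * (Ei + Ee) ≤ (A + B) * (a ^ 2 * G + H) := by
    have e1 : κ * Ei ≤ 1 / (2 * ε) * Ei := mul_le_mul_of_nonneg_right (min_le_left _ _) hEi
    have e2 : κ * Ee ≤ 1 * Ee := mul_le_mul_of_nonneg_right (min_le_right _ _) hEe
    have e3 : A * a ^ 2 * G₀ ≤ A * a ^ 2 * G := mul_le_mul_of_nonneg_left hiG (by positivity)
    have e4 : 0 ≤ A * H := by positivity
    have e5 : 0 ≤ B * (a ^ 2 * G) := by positivity
    linarith
  have hE : Ei + Ee ≤ C ^ 2 * (a ^ 2 * G + H) := by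
    rw [hC2, div_mul_eq_mul_div, le_div_iff₀ hκ]
    linarith
  have hroot : Real.sqrt (Ei + Ee) ≤ C * a * Real.sqrt G + C * Real.sqrt H := by
    refine Real.sqrt_le_iff.2 ⟨by positivity, hE.trans ?_⟩
    have s1 := Real.sq_sqrt hG0
    have s2 := Real.sq_sqrt hH0
    have s3 : 0 ≤ C * a * Real.sqrt G * (C * Real.sqrt H) := by positivity
    nth_rewrite 1 [← s1, ← s2]
    linarith
  refine hroot.trans (add_le_add ?_ ?_)
  · gcongr
  · refine mul_le_mul_of_nonneg_right ?_ (Real.sqrt_nonneg _)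
    rw [le_div_iff₀ ha]
    gcongr
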